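/- arXiv:2510.01352 — 11 statements merged into one kernel-verified Lean document; each statement's English description precedes it below -/
import Mathlib

section
/- Let A be a Banach algebra over ℝ with unit, let n ≥ 1, let P : ℝ → A be n-times continuously differentiable, and suppose 1 − P(y) is invertible for every y ∈ ℝ. Define V : ℝ → A by V(y) = (1 − P(y))⁻¹. Then for every x ∈ ℝ, the n-th derivative of V at x equals the sum over all compositions (a₁, …, a_k) of n of χ(a₁, …, a_k) • ( V(x) * P^{(a₁)}(x) * V(x) * P^{(a₂)}(x) * ⋯ * V(x) * P^{(a_k)}(x) * V(x) ), where P^{(a)} denotes the a-th derivative of P and χ(a₁, …, a_k) := ∏_{ℓ=1}^{k} C(a_ℓ + a_{ℓ+1} + ⋯ + a_k, a_ℓ) with C(·,·) the binomial coefficient. -/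
/-- `χ(a₁, …, a_k) = ∏_{ℓ=1}^{k} C(a_ℓ + ⋯ + a_k, a_ℓ)` for a composition with blocks
`a₁, …, a_k`. -/
def chiC {n : ℕ} (c : Composition n) : ℕ :=
  ∏ i ∈ Finset.range c.length,
    Nat.choose ((c.blocks.drop i).sum) (c.blocks.getD i 0)

theorem chi_sum_succ {A : Type*} [Ring A] (n : ℕ) (V : A) (p : ℕ → A) :
    (∑ c : Composition (n + 1), chiC c • (V * (c.blocks.map fun a => p a * V).prod)) =
      ∑ i ∈ Finset.range (n + 1), V * ((n + 1).choose (i + 1) • (p (i + 1) *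
        ∑ c : Composition (n - i), chiC c • (V * (c.blocks.map fun a => p a * V).prod))) := by
  rw [Finset.sum_range fun i => V * ((n + 1).choose (i + 1) • (p (i + 1) *
        ∑ c : Composition (n - i), chiC c • (V * (c.blocks.map fun a => p a * V).prod)))]
  simp only [Finset.mul_sum, Finset.smul_sum]
  rw [Finset.sum_sigma']
  symm
  refine Finset.sum_bij
    (fun (s : Σ i : Fin (n + 1), Composition (n - i)) _ =>
      (⟨(s.1.1 + 1) :: s.2.blocks, ?_, ?_⟩ : Composition (n + 1))) ?_ ?_ ?_ ?_
  · intro i hi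
    rcases List.mem_cons.1 hi with h | h
    · omega
    · exact s.2.blocks_pos h
  · have := s.1.2
    simp only [List.sum_cons, s.2.blocks_sum]
    omega
  · intros; simp
  · rintro ⟨⟨i, hi⟩, c⟩ _ ⟨⟨j, hj⟩, d⟩ _ h
    simp only [Composition.mk.injEq, List.cons.injEq, add_left_inj] at h
    obtain ⟨rfl, h⟩ := h
    have : c = d := Composition.ext h
    rw [this]
  · rintro ⟨l, hl, hs⟩ _
    cases l with
    | nil => simp at hs
    | cons a l =>
      have ha : 0 < a := hl (by simp)
      simp only [List.sum_cons] at hs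
      refine ⟨⟨⟨a - 1, by omega⟩, ⟨l, fun h => hl (by simp [h]), by
        simp only; omega⟩⟩, by simp, ?_⟩
      apply Composition.ext
      change (a - 1 + 1) :: l = a :: l
      rw [Nat.sub_add_cancel ha]
  · rintro ⟨⟨i, hi⟩, c⟩ _
    have hs : (i + 1) + c.blocks.sum = n + 1 := by rw [c.blocks_sum]; simp only; omega
    simp only [chiC, Composition.length, List.length_cons, Finset.prod_range_succ',
      List.drop_succ_cons, List.getD_cons_succ, List.drop_zero, List.sum_cons,
      List.getD_cons_zero, hs, List.map_cons, List.prod_cons]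
    simp only [mul_smul_comm, smul_smul, mul_assoc]
    rw [mul_comm]

/-- The derivative expansion of `V = (1 − P)⁻¹` in a Banach algebra: the `n`-th derivative
of `V` at `x` is the sum over all compositions `(a₁, …, a_k)` of `n` of
`χ(a₁, …, a_k) • (V x * P^{(a₁)}(x) * V x * ⋯ * V x * P^{(a_k)}(x) * V x)`. -/
theorem iteratedDeriv_inverse_one_sub {A : Type*} [NormedRing A] [NormedAlgebra ℝ A]
    [CompleteSpace A] (n : ℕ) (hn : 1 ≤ n) (P : ℝ → A) (hP : ContDiff ℝ (n : ℕ∞) P)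
    (hu : ∀ y : ℝ, IsUnit (1 - P y)) (x : ℝ) :
    iteratedDeriv n (fun y => Ring.inverse (1 - P y)) x =
      ∑ c : Composition n,
        chiC c • (Ring.inverse (1 - P x) *
          (c.blocks.map fun a => iteratedDeriv a P x * Ring.inverse (1 - P x)).prod) := by
  have hV : ContDiff ℝ (n : ℕ∞) (fun y => Ring.inverse (1 - P y)) := by
    rw [contDiff_iff_contDiffAt]
    intro y
    obtain ⟨u, hu'⟩ := hu y
    have h := contDiffAt_ringInverse ℝ (n := (n : ℕ∞)) u
    rw [hu'] at h
    exact h.comp y (contDiffAt_const.sub hP.contDiffAt)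
  clear hn
  induction n using Nat.strong_induction_on with
  | _ n ih =>
  cases n with
  | zero =>
    have e : ∀ c : Composition 0, c.blocks = [] := fun c => c.blocks_eq_nil.2 rfl
    simp [chiC, Composition.length, e, composition_card]
  | succ n =>
    rw [chi_sum_succ n (Ring.inverse (1 - P x)) (fun a => iteratedDeriv a P x)]
    have h1 : iteratedDeriv (n + 1) ((fun y => 1 - P y) * fun y => Ring.inverse (1 - P y)) x
        = 0 := by
      have : ((fun y => 1 - P y) * fun y => Ring.inverse (1 - P y)) = fun _ => (1 : A) := by
        funext y
        exact Ring.mul_inverse_cancel _ (hu y)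
      rw [this, iteratedDeriv_const]
      simp
    rw [iteratedDeriv_mul (contDiffAt_const.sub hP.contDiffAt) hV.contDiffAt,
      Finset.sum_range_succ'] at h1
    have h2 := eq_neg_of_add_eq_zero_right h1
    simp only [Nat.choose_zero_right, Nat.cast_one, one_mul, iteratedDeriv_zero,
      Nat.sub_zero] at h2
    have h4 := Ring.inverse_mul_cancel_left _ (iteratedDeriv (n + 1)
      (fun y => Ring.inverse (1 - P y)) x) (hu x)
    rw [← h4, h2, ← Finset.sum_neg_distrib, Finset.mul_sum]
    refine Finset.sum_congr rfl fun i hi => ?_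
    have hi' := Finset.mem_range.1 hi
    have hle : ((n - i : ℕ) : ℕ∞) ≤ ((n + 1 : ℕ) : ℕ∞) := by
      exact_mod_cast (by omega : n - i ≤ n + 1)
    rw [← ih (n - i) (by omega) (hP.of_le (by exact_mod_cast hle))
      (hV.of_le (by exact_mod_cast hle))]
    have e : n + 1 - (i + 1) = n - i := by omega
    have h3 : iteratedDeriv (i + 1) (fun y => 1 - P y) x = - iteratedDeriv (i + 1) P x := by
      rw [iteratedDeriv_const_sub (by omega), iteratedDeriv_neg]
    rw [h3, e, nsmul_eq_mul]
    simp only [mul_neg, neg_mul, neg_neg, mul_assoc]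
end

section
/- For every n ∈ ℕ, in the free ℤ-module on planar binary rooted trees one has Σ_{τ : ‖τ‖ = n} α(τ) • B_∨(τ) = Σ_{σ : ‖σ‖ = n+1} α(σ) • σ, where both sums are over the finitely many trees of the indicated grade. -/
inductive PTree : Type
  | leaf : PTree
  | node : PTree → PTree → PTree
  deriving DecidableEq

namespace PTree

/-- The grade of a planar binary rooted tree: its number of binary (internal) nodes. -/
def grade : PTree → ℕ
  | leaf => 0
  | node t1 t2 => grade t1 + grade t2 + 1

/-- The weight character of a planar binary rooted tree. -/
def alpha : PTree → ℕ
  | leaf => 1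
  | node t1 t2 => Nat.choose (grade t1 + grade t2) (grade t1) * alpha t1 * alpha t2

end PTree

/-- The (finite) set of all planar binary rooted trees of a given grade. -/
def treesOfGrade : ℕ → Finset PTree
  | 0 => {PTree.leaf}
  | n + 1 =>
    (Finset.range (n + 1)).attach.biUnion fun j =>
      (treesOfGrade j.1 ×ˢ treesOfGrade (n - j.1)).image fun p => PTree.node p.1 p.2
termination_by n => n
decreasing_by
  · exact Finset.mem_range.mp j.2
  · exact Nat.lt_succ_of_le (Nat.sub_le n j.1)

/-- The branching operator `B_∨` on the free `ℤ`-module on planar binary rooted trees: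
it sends a tree `τ` to the sum, over the leaves of `τ`, of the trees obtained by replacing
that leaf with `node leaf leaf`. -/
noncomputable def Bv : PTree → (PTree →₀ ℤ)
  | .leaf => Finsupp.single (.node .leaf .leaf) 1
  | .node t1 t2 =>
      Finsupp.mapDomain (fun s => PTree.node s t2) (Bv t1) +
      Finsupp.mapDomain (fun s => PTree.node t1 s) (Bv t2)

/-- Bilinear grafting. -/
noncomputable def graft : (PTree →₀ ℤ) →ₗ[ℤ] (PTree →₀ ℤ) →ₗ[ℤ] (PTree →₀ ℤ) :=
  Finsupp.linearCombination ℤ (fun a => Finsupp.lmapDomain ℤ ℤ (PTree.node a))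

theorem graft_single_left (a : PTree) (x : ℤ) (v : PTree →₀ ℤ) :
    graft (Finsupp.single a x) v = x • Finsupp.mapDomain (fun s => PTree.node a s) v := by
  simp [graft, Finsupp.linearCombination_single, Finsupp.lmapDomain_apply]

theorem graft_single_right (u : PTree →₀ ℤ) (b : PTree) (y : ℤ) :
    graft u (Finsupp.single b y) = y • Finsupp.mapDomain (fun s => PTree.node s b) u := by
  induction u using Finsupp.induction_linear with
  | zero => simp
  | add f g hf hg => simp only [map_add, LinearMap.add_apply, hf, hg, Finsupp.mapDomain_add, smul_add]
  | single a x =>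
    rw [graft_single_left]
    simp [Finsupp.mapDomain_single, mul_comm]

theorem grade_of_mem (n : ℕ) : ∀ t ∈ treesOfGrade n, t.grade = n := by
  induction n using Nat.strong_induction_on with
  | _ n ih =>
    intro t ht
    cases n with
    | zero =>
      rw [treesOfGrade] at ht
      simp at ht
      subst ht
      rfl
    | succ n =>
      rw [treesOfGrade] at ht
      simp only [Finset.mem_biUnion, Finset.mem_image, Finset.mem_product] at ht
      obtain ⟨j, -, p, ⟨h1, h2⟩, rfl⟩ := ht
      have hj := Finset.mem_range.mp j.2
      have e1 := ih _ hj _ h1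
      have e2 := ih _ (by omega) _ h2
      simp only [PTree.grade, e1, e2]
      omega

theorem sum_trees_succ {M : Type*} [AddCommMonoid M] (n : ℕ) (f : PTree → M) :
    ∑ t ∈ treesOfGrade (n + 1), f t =
      ∑ ij ∈ Finset.HasAntidiagonal.antidiagonal n, ∑ a ∈ treesOfGrade ij.1, ∑ b ∈ treesOfGrade ij.2,
        f (PTree.node a b) := by
  rw [Finset.Nat.sum_antidiagonal_eq_sum_range_succ
    (fun i j => ∑ a ∈ treesOfGrade i, ∑ b ∈ treesOfGrade j, f (PTree.node a b)), treesOfGrade,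
    Finset.sum_biUnion, ← Finset.sum_attach (Finset.range n.succ)]
  · refine Finset.sum_congr rfl fun j _ => ?_
    rw [Finset.sum_image, Finset.sum_product]
    rintro ⟨a, b⟩ _ ⟨c, d⟩ _ h
    simpa using h
  · intro i _ j _ hij
    rw [Function.onFun, Finset.disjoint_left]
    intro t h1 h2
    simp only [Finset.mem_image, Finset.mem_product] at h1 h2
    obtain ⟨p, ⟨hp, -⟩, rfl⟩ := h1
    obtain ⟨q, ⟨hq, -⟩, h⟩ := h2
    injection h with h3 h4
    rw [h3] at hq
    exact hij (Subtype.ext ((grade_of_mem _ _ hp).symm.trans (grade_of_mem _ _ hq)))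

/-- The weighted tree sum. -/
noncomputable def pSum (n : ℕ) : PTree →₀ ℤ :=
  ∑ σ ∈ treesOfGrade n, Finsupp.single σ (PTree.alpha σ : ℤ)

/-- The branched weighted tree sum. -/
noncomputable def qSum (n : ℕ) : PTree →₀ ℤ :=
  ∑ τ ∈ treesOfGrade n, (PTree.alpha τ : ℤ) • Bv τ

theorem pSum_succ (n : ℕ) :
    pSum (n + 1) = ∑ ij ∈ Finset.HasAntidiagonal.antidiagonal n, n.choose ij.1 • graft (pSum ij.1) (pSum ij.2) := by
  rw [pSum, sum_trees_succ]
  refine Finset.sum_congr rfl fun ij hij => ?_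
  rw [Finset.HasAntidiagonal.mem_antidiagonal] at hij
  simp only [pSum, map_sum, LinearMap.sum_apply, Finset.smul_sum]
  rw [Finset.sum_comm]
  refine Finset.sum_congr rfl fun b hb => Finset.sum_congr rfl fun a ha => ?_
  rw [graft_single_left]
  simp only [PTree.alpha, grade_of_mem _ _ ha, grade_of_mem _ _ hb, hij,
    Finsupp.mapDomain_single, Finsupp.smul_single]
  congr 1
  simp [mul_assoc]

theorem qSum_succ (n : ℕ) :
    qSum (n + 1) = ∑ ij ∈ Finset.HasAntidiagonal.antidiagonal n, n.choose ij.1 •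
      (graft (qSum ij.1) (pSum ij.2) + graft (pSum ij.1) (qSum ij.2)) := by
  rw [qSum, sum_trees_succ]
  refine Finset.sum_congr rfl fun ij hij => ?_
  rw [Finset.HasAntidiagonal.mem_antidiagonal] at hij
  simp only [pSum, qSum, map_sum, LinearMap.sum_apply, ← Finset.sum_add_distrib, Finset.smul_sum]
  rw [Finset.sum_comm]
  refine Finset.sum_congr rfl fun b hb => Finset.sum_congr rfl fun a ha => ?_
  rw [graft_single_left, graft_single_right]
  simp only [PTree.alpha, grade_of_mem _ _ ha, grade_of_mem _ _ hb, hij, Bv,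
    Finsupp.mapDomain_smul, ← Nat.cast_smul_eq_nsmul ℤ, smul_add, smul_smul]
  push_cast
  congr 2 <;> ring

theorem qSum_eq (n : ℕ) : qSum n = pSum (n + 1) := by
  induction n using Nat.strong_induction_on with
  | _ n ih =>
    cases n with
    | zero =>
      rw [pSum_succ]
      simp [qSum, pSum, treesOfGrade, Bv, PTree.alpha, graft_single_left, Finsupp.mapDomain_single]
      rw [← Finsupp.single_mul, mul_one]
    | succ n =>
      rw [qSum_succ, pSum_succ,
        Finset.sum_antidiagonal_choose_succ_nsmul (fun i j => graft (pSum i) (pSum j)),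
        ← Finset.sum_add_distrib]
      refine Finset.sum_congr rfl fun ij hij => ?_
      rw [Finset.HasAntidiagonal.mem_antidiagonal] at hij
      rw [ih ij.1 (by omega), ih ij.2 (by omega), smul_add, add_comm,
        Nat.choose_symm_of_eq_add (n := n) (a := ij.1) (b := ij.2) hij.symm]

/-- Branching the weighted tree sum `𝔭_n` gives `𝔭_{n+1}`:
`Σ_{‖τ‖=n} α(τ) • B_∨(τ) = Σ_{‖σ‖=n+1} α(σ) • σ` in the free `ℤ`-module on trees. -/
theorem branch_weighted_sum (n : ℕ) :
    ∑ τ ∈ treesOfGrade n, (PTree.alpha τ : ℤ) • Bv τ =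
      ∑ σ ∈ treesOfGrade (n + 1), Finsupp.single σ (PTree.alpha σ : ℤ) := by
  exact qSum_eq n
end

section
/- Let n ≥ 1 and D ⊆ {1,…,n−1}, and set M := { m ∈ {0} ∪ D : m + 1 ∉ D }. Then the map sending m ∈ M to the ordered pair of descents ( (m, {d ∈ D : d < m}), (n − m − 1, {d − m − 1 : d ∈ D, d > m + 1}) ) is injective, and its image is exactly the set of all ordered pairs (𝔡₁, 𝔡₂) of descents with 𝔡₁ ⋆ 𝔡₂ = (n, D). -/
/-- A descent: a grade `n` together with a subset of `{1, …, n-1}`. -/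
structure Descent : Type where
  grade : ℕ
  dset : Finset ℕ
  valid : dset ⊆ Finset.Icc 1 (grade - 1)

instance : DecidableEq Descent := fun a b =>
  decidable_of_iff (a.grade = b.grade ∧ a.dset = b.dset) (by
    constructor
    · rintro ⟨h1, h2⟩
      obtain ⟨g1, s1, v1⟩ := a
      obtain ⟨g2, s2, v2⟩ := b
      dsimp at h1 h2
      subst h1; subst h2; rfl
    · rintro rfl; exact ⟨rfl, rfl⟩)

/-- The empty descent `∅₀` of grade `0`. -/
def emptyDescent : Descent := ⟨0, ∅, by simp⟩

/-- The grafting product of two descents. -/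
def dstar (a b : Descent) : Descent where
  grade := a.grade + b.grade + 1
  dset := a.dset ∪ b.dset.image (fun e => e + a.grade + 1) ∪
    (if 1 ≤ a.grade then {a.grade} else ∅)
  valid := by
    intro x hx
    simp only [Finset.mem_union, Finset.mem_image] at hx
    simp only [Finset.mem_Icc]
    rcases hx with (hx | hx) | hx
    · have h := Finset.mem_Icc.mp (a.valid hx); omega
    · obtain ⟨e, he, rfl⟩ := hx
      have h := Finset.mem_Icc.mp (b.valid he); omega
    · split_ifs at hx with h
      · rw [Finset.mem_singleton] at hx; omega
      · simp at hx

/-- The descent of a planar binary rooted tree. -/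
def desc : PTree → Descent
  | .leaf => emptyDescent
  | .node t1 t2 => dstar (desc t1) (desc t2)

/-- The weight of a descent: the sum of the weight characters `α(τ)` over all (finitely many)
planar binary rooted trees `τ` with `desc τ = d`. -/
noncomputable def omegaD (d : Descent) : ℕ :=
  ∑ᶠ (τ : PTree) (_ : desc τ = d), PTree.alpha τ

/-- The (finite) set of all descents of a given grade. -/
def descentsOfGrade (n : ℕ) : Finset Descent :=
  (Finset.Icc 1 (n - 1)).powerset.attach.image fun D =>
    ⟨n, D.1, Finset.mem_powerset.mp D.2⟩

/-- The candidate degrafting pairs of the descent `(n, D)`: for a split point `m`,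
the pair `((m, {d ∈ D : d < m}), (n − m − 1, {d − m − 1 : d ∈ D, d > m + 1}))`. -/
def degraftPair (n : ℕ) (D : Finset ℕ) (hD : D ⊆ Finset.Icc 1 (n - 1)) (m : ℕ) :
    Descent × Descent :=
  (⟨m, D.filter fun d => d < m, by
      intro x hx
      simp only [Finset.mem_filter] at hx
      have h := Finset.mem_Icc.mp (hD hx.1)
      simp only [Finset.mem_Icc]
      omega⟩,
   ⟨n - m - 1, (D.filter fun d => m + 1 < d).image fun d => d - m - 1, by
      intro x hx
      simp only [Finset.mem_image, Finset.mem_filter] at hx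
      obtain ⟨e, ⟨heD, hem⟩, rfl⟩ := hx
      have h := Finset.mem_Icc.mp (hD heD)
      simp only [Finset.mem_Icc]
      omega⟩)

/-- Characterisation of the degrafting of a descent `(n, D)` with `n ≥ 1`: the map
`m ↦ ((m, {d ∈ D : d < m}), (n − m − 1, {d − m − 1 : d ∈ D, d > m + 1}))` is injective on
`M = {m ∈ {0} ∪ D : m + 1 ∉ D}`, and its image is exactly the set of all ordered pairs of
descents whose grafting product is `(n, D)`. -/
theorem degraft_characterisation (n : ℕ) (hn : 1 ≤ n) (D : Finset ℕ)
    (hD : D ⊆ Finset.Icc 1 (n - 1)) :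
    Set.InjOn (degraftPair n D hD) ↑((insert 0 D).filter fun m => m + 1 ∉ D) ∧
      degraftPair n D hD '' ↑((insert 0 D).filter fun m => m + 1 ∉ D) =
        {q : Descent × Descent | dstar q.1 q.2 = ⟨n, D, hD⟩} := by
  have ext' : ∀ a b : Descent, a.grade = b.grade → (∀ x, x ∈ a.dset ↔ x ∈ b.dset) → a = b := by
    rintro ⟨g1, s1, v1⟩ ⟨g2, s2, v2⟩ h1 h2
    have h3 : s1 = s2 := Finset.ext h2
    dsimp at h1
    subst h1; subst h3; rfl
  refine ⟨fun m _ m' _ h => congrArg (fun q : Descent × Descent => q.1.grade) h, ?_⟩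
  have hD' : ∀ x ∈ D, 1 ≤ x ∧ x ≤ n - 1 := fun x hx => Finset.mem_Icc.mp (hD hx)
  ext ⟨a, b⟩
  simp only [Set.mem_image, Finset.mem_coe, Finset.mem_filter, Finset.mem_insert,
    Set.mem_setOf_eq]
  constructor
  · rintro ⟨m, ⟨hm, hm1⟩, h⟩
    obtain ⟨rfl, rfl⟩ := Prod.mk.inj h
    apply ext'
    · simp only [dstar]
      rcases hm with rfl | hm
      · omega
      · have := hD' m hm
        omega
    · intro x
      simp only [dstar, Finset.mem_union, Finset.mem_image, Finset.mem_filter]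
      constructor
      · rintro ((h | ⟨e, ⟨d, ⟨hd, hd2⟩, rfl⟩, rfl⟩) | h)
        · exact h.1
        · have : d - m - 1 + m + 1 = d := by omega
          rwa [this]
        · split_ifs at h with h0
          · rw [Finset.mem_singleton] at h
            subst h
            exact hm.resolve_left (by omega)
          · simp at h
      · intro hx
        have hx1 := hD' x hx
        rcases lt_trichotomy x m with h | h | h
        · exact Or.inl (Or.inl ⟨hx, h⟩)
        · right
          rw [if_pos (by omega), Finset.mem_singleton]
          exact h
        · have : x ≠ m + 1 := fun h' => hm1 (h' ▸ hx)
          exact Or.inl (Or.inr ⟨x - m - 1, ⟨x, ⟨hx, by omega⟩, rfl⟩, by omega⟩)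
  · intro h
    have hg : a.grade + b.grade + 1 = n := congrArg Descent.grade h
    have hs : ∀ x, x ∈ D ↔ (x ∈ a.dset ∨ ∃ e ∈ b.dset, e + a.grade + 1 = x) ∨
        (1 ≤ a.grade ∧ x = a.grade) := by
      intro x
      have h2 : (dstar a b).dset = D := congrArg Descent.dset h
      rw [← h2]
      simp only [dstar, Finset.mem_union, Finset.mem_image]
      split_ifs with h0 <;> simp [h0]
    have ha : ∀ x ∈ a.dset, 1 ≤ x ∧ x ≤ a.grade - 1 := fun x hx => Finset.mem_Icc.mp (a.valid hx)
    have hb : ∀ x ∈ b.dset, 1 ≤ x ∧ x ≤ b.grade - 1 := fun x hx => Finset.mem_Icc.mp (b.valid hx)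
    refine ⟨a.grade, ⟨?_, ?_⟩, ?_⟩
    · rcases Nat.eq_zero_or_pos a.grade with h0 | h0
      · exact Or.inl h0
      · exact Or.inr ((hs _).2 (Or.inr ⟨h0, rfl⟩))
    · rw [hs]
      rintro ((h | ⟨e, he, h⟩) | h)
      · have := ha _ h
        omega
      · have := hb _ he
        omega
      · omega
    · refine Prod.ext (ext' _ _ rfl ?_) (ext' _ _ ?_ ?_)
      · intro x
        simp only [degraftPair, Finset.mem_filter]
        rw [hs]
        constructor
        · rintro ⟨(h | ⟨e, he, h⟩) | h, hx⟩
          · exact h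
          · omega
          · omega
        · intro h
          have := ha _ h
          exact ⟨Or.inl (Or.inl h), by omega⟩
      · simp only [degraftPair]
        omega
      · intro x
        simp only [degraftPair, Finset.mem_filter, Finset.mem_image]
        constructor
        · rintro ⟨d, ⟨hd, hd2⟩, rfl⟩
          rw [hs] at hd
          rcases hd with (h | ⟨e, he, rfl⟩) | h
          · have := ha _ h
            omega
          · have : e + a.grade + 1 - a.grade - 1 = e := by omega
            rwa [this]
          · omega
        · intro h
          have := hb _ h
          exact ⟨x + a.grade + 1, ⟨(hs _).2 (Or.inl (Or.inr ⟨x, h, rfl⟩)), by omega⟩, by omega⟩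
end

section
/- Let n ≥ 1, ℓ ≥ 1 and 1 ≤ d₁ < d₂ < ⋯ < d_ℓ ≤ n−1. Then, with ω the descent weight, (ω((n, {d₁,…,d_ℓ})) : ℤ) = Σ_{S ⊆ {1,…,ℓ}} (−1)^{|S|+ℓ} · C(n, d_{p₁}) · ∏_{i=2}^{|S|} C(n − d_{p_{i−1}}, d_{p_i} − d_{p_{i−1}}), where for nonempty S one writes S = {p₁ < p₂ < ⋯ < p_{|S|}} and the empty set S = ∅ contributes (−1)^ℓ. -/
/-- `chainProdAux n prev [b₁, …, b_j] = C(n − prev, b₁ − prev) · C(n − b₁, b₂ − b₁) ⋯`. -/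
def chainProdAux (n : ℕ) : ℕ → List ℕ → ℕ
  | _, [] => 1
  | prev, b :: t => Nat.choose (n - prev) (b - prev) * chainProdAux n b t

/-- `chainProd n [a₁, …, a_j] = C(n, a₁) · C(n − a₁, a₂ − a₁) ⋯ C(n − a_{j−1}, a_j − a_{j−1})`,
with the empty list giving `1`. -/
def chainProd (n : ℕ) : List ℕ → ℕ
  | [] => 1
  | a :: t => Nat.choose n a * chainProdAux n a t

open Classical in
/-- Total weight of the trees of grade `n` with descent set contained in `P`. -/
noncomputable def subW (n : ℕ) (P : ℕ → Prop) : ℕ :=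
  ∑ t ∈ treesOfGrade n, if (∀ e ∈ (desc t).dset, P e) then PTree.alpha t else 0

theorem mem_treesOfGrade (t : PTree) : ∀ n, t ∈ treesOfGrade n ↔ t.grade = n := by
  induction t with
  | leaf =>
    intro n
    cases n with
    | zero => simp [treesOfGrade, PTree.grade]
    | succ n => simp [treesOfGrade, PTree.grade]
  | node a b iha ihb =>
    intro n
    cases n with
    | zero => simp [treesOfGrade, PTree.grade]
    | succ n =>
      rw [treesOfGrade]
      simp only [Finset.mem_biUnion, Finset.mem_attach, true_and, Finset.mem_image,
        Finset.mem_product, Prod.exists, Subtype.exists, Finset.mem_range, PTree.grade,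
        PTree.node.injEq]
      constructor
      · rintro ⟨j, hj, x, y, ⟨hx, hy⟩, rfl, rfl⟩
        rw [iha] at hx
        rw [ihb] at hy
        omega
      · intro h
        refine ⟨a.grade, by omega, a, b, ⟨(iha _).2 rfl, (ihb _).2 (by omega)⟩, rfl, rfl⟩

theorem desc_grade (t : PTree) : (desc t).grade = t.grade := by
  induction t with
  | leaf => rfl
  | node a b iha ihb => simp [desc, dstar, PTree.grade, iha, ihb]

theorem sum_trees_succ_s7 (n : ℕ) (f : PTree → ℕ) :
    ∑ t ∈ treesOfGrade (n + 1), f t =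
      ∑ j ∈ Finset.range (n + 1), ∑ a ∈ treesOfGrade j, ∑ b ∈ treesOfGrade (n - j),
        f (.node a b) := by
  rw [treesOfGrade, Finset.sum_biUnion]
  · rw [← Finset.sum_attach (Finset.range (n + 1))]
    refine Finset.sum_congr rfl fun j _ => ?_
    rw [Finset.sum_image, Finset.sum_product]
    rintro ⟨a, b⟩ _ ⟨c, d⟩ _ h
    simpa using h
  · intro i _ j _ hij
    refine Finset.disjoint_left.2 fun t ht ht' => hij ?_
    simp only [Finset.mem_image, Finset.mem_product, mem_treesOfGrade] at ht ht'
    obtain ⟨p, hp, rfl⟩ := ht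
    obtain ⟨q, hq, h⟩ := ht'
    simp only [PTree.node.injEq] at h
    apply Subtype.ext
    rw [← hp.1, ← hq.1, h.1]

theorem subW_zero (P : ℕ → Prop) : subW 0 P = 1 := by
  simp [subW, treesOfGrade, desc, emptyDescent, PTree.alpha]

open Classical in
theorem subW_succ (n : ℕ) (P : ℕ → Prop) :
    subW (n + 1) P = ∑ j ∈ Finset.range (n + 1),
      if (j = 0 ∨ P j) then n.choose j * subW j P * subW (n - j) (fun e => P (e + j + 1))
      else 0 := by
  unfold subW
  rw [sum_trees_succ_s7]
  refine Finset.sum_congr rfl fun j hj => ?_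
  have hj' := Finset.mem_range.1 hj
  have key : ∀ a ∈ treesOfGrade j, ∀ b ∈ treesOfGrade (n - j),
      (if (∀ e ∈ (desc (.node a b)).dset, P e) then PTree.alpha (.node a b) else 0) =
      if (j = 0 ∨ P j) then n.choose j *
        (if (∀ e ∈ (desc a).dset, P e) then PTree.alpha a else 0) *
        (if (∀ e ∈ (desc b).dset, P (e + j + 1)) then PTree.alpha b else 0) else 0 := by
    intro a ha b hb
    rw [mem_treesOfGrade] at ha hb
    have h1 : (∀ e ∈ (desc (.node a b)).dset, P e) ↔
        (j = 0 ∨ P j) ∧ (∀ e ∈ (desc a).dset, P e) ∧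
          (∀ e ∈ (desc b).dset, P (e + j + 1)) := by
      simp only [desc, dstar, desc_grade, ha, Finset.mem_union, Finset.mem_image]
      constructor
      · intro h
        refine ⟨?_, fun e he => h e (Or.inl (Or.inl he)),
          fun e he => h _ (Or.inl (Or.inr ⟨e, he, rfl⟩))⟩
        rcases Nat.eq_zero_or_pos j with h0 | h0
        · exact Or.inl h0
        · refine Or.inr (h j (Or.inr ?_))
          rw [if_pos (by omega)]; simp
      · rintro ⟨h0, h1, h2⟩ e ((he | ⟨x, hx, rfl⟩) | he)
        · exact h1 e he
        · exact h2 x hx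
        · split_ifs at he with hh
          · rw [Finset.mem_singleton] at he
            subst he
            rcases h0 with h0 | h0
            · omega
            · exact h0
          · simp at he
    have h2 : PTree.alpha (.node a b) = n.choose j * a.alpha * b.alpha := by
      rw [PTree.alpha, ha, hb]
      congr 3
      omega
    simp only [h1, h2]
    split_ifs <;> first | rfl | (exfalso; tauto) | simp
  rw [Finset.sum_congr rfl fun a ha => Finset.sum_congr rfl fun b hb => key a ha b hb]
  split_ifs
  · rw [mul_assoc, Finset.sum_mul_sum, Finset.mul_sum]
    refine Finset.sum_congr rfl fun a _ => ?_
    rw [Finset.mul_sum]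
    exact Finset.sum_congr rfl fun b _ => by rw [mul_assoc]
  · simp

theorem subW_congr (n : ℕ) (P Q : ℕ → Prop) (h : ∀ e, 1 ≤ e → e < n → (P e ↔ Q e)) :
    subW n P = subW n Q := by
  unfold subW
  refine Finset.sum_congr rfl fun t ht => ?_
  rw [mem_treesOfGrade] at ht
  have : (∀ e ∈ (desc t).dset, P e) ↔ (∀ e ∈ (desc t).dset, Q e) := by
    refine forall₂_congr fun e he => ?_
    have := Finset.mem_Icc.1 ((desc t).valid he)
    rw [desc_grade, ht] at this
    exact h e (by omega) (by omega)
  classical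
  split_ifs <;> first | rfl | (exfalso; tauto)

theorem subW_none (n : ℕ) : subW n (fun _ => False) = 1 := by
  induction n with
  | zero => exact subW_zero _
  | succ n ih =>
    rw [subW_succ, Finset.sum_eq_single 0]
    · simp [subW_zero, ih]
    · intro b _ hb
      simp [hb]
    · simp

theorem subW_mul (n : ℕ) : ∀ (m : ℕ) (P : ℕ → Prop), m ≤ n → (m = 0 ∨ P m) →
    subW n P = n.choose m * subW m P * subW (n - m) (fun e => P (e + m)) := by
  classical
  induction n using Nat.strong_induction_on with
  | _ n ih =>
  intro m P hm hP
  rcases Nat.eq_zero_or_pos m with rfl | hm0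
  · simp [subW_zero]
  rcases Nat.eq_or_lt_of_le hm with rfl | hlt
  · simp [subW_zero]
  obtain ⟨n, rfl⟩ : ∃ k, n = k + 1 := ⟨n - 1, by omega⟩
  obtain ⟨m, rfl⟩ : ∃ k, m = k + 1 := ⟨m - 1, by omega⟩
  have hPm : P (m + 1) := by simpa using hP
  obtain ⟨r, rfl⟩ : ∃ r, n = m + 1 + r := ⟨n - m - 1, by omega⟩
  rw [subW_succ, show m + 1 + r + 1 = (m + 1) + (r + 1) by ring, Finset.sum_range_add]
  have e1 : ∑ j ∈ Finset.range (m + 1),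
      (if (j = 0 ∨ P j) then (m + 1 + r).choose j * subW j P *
        subW (m + 1 + r - j) (fun e => P (e + j + 1)) else 0) =
      (m + 1 + r).choose m * subW (m + 1) P * subW (r + 1) (fun e => P (e + (m + 1))) := by
    rw [subW_succ m P, Finset.mul_sum, Finset.sum_mul]
    refine Finset.sum_congr rfl fun j hj => ?_
    have hj := Finset.mem_range.1 hj
    split_ifs with hc
    · rw [ih (m + 1 + r - j) (by omega) (m - j) (fun e => P (e + j + 1)) (by omega)
        (by right; rwa [show m - j + j + 1 = m + 1 by omega])]
      rw [show m + 1 + r - j - (m - j) = r + 1 by omega]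
      have hf : (fun e => P (e + (m - j) + j + 1)) = (fun e => P (e + (m + 1))) := by
        funext e
        rw [show e + (m - j) + j + 1 = e + (m + 1) by omega]
      rw [hf]
      have hch := Nat.choose_mul (n := m + 1 + r) (k := m) (s := j) (by omega)
      calc _ = ((m + 1 + r).choose j * (m + 1 + r - j).choose (m - j)) * subW j P *
            subW (m - j) (fun e => P (e + j + 1)) * subW (r + 1) (fun e => P (e + (m + 1))) := by
              ring
        _ = _ := by rw [← hch]; ring
    · simp
  have e2 : ∑ i ∈ Finset.range (r + 1),
      (if (m + 1 + i = 0 ∨ P (m + 1 + i)) then (m + 1 + r).choose (m + 1 + i) *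
        subW (m + 1 + i) P *
        subW (m + 1 + r - (m + 1 + i)) (fun e => P (e + (m + 1 + i) + 1)) else 0) =
      (m + 1 + r).choose (m + 1) * subW (m + 1) P *
        subW (r + 1) (fun e => P (e + (m + 1))) := by
    rw [subW_succ r, Finset.mul_sum]
    refine Finset.sum_congr rfl fun i hi => ?_
    have hi := Finset.mem_range.1 hi
    have hc : (m + 1 + i = 0 ∨ P (m + 1 + i)) ↔ (i = 0 ∨ P (i + (m + 1))) := by
      rw [add_comm i]
      constructor
      · rintro (h | h)
        · omega
        · exact Or.inr h
      · rintro (rfl | h)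
        · exact Or.inr hPm
        · exact Or.inr h
    simp only [hc]
    split_ifs
    · rw [ih (m + 1 + i) (by omega) (m + 1) P (by omega) (Or.inr hPm)]
      rw [show m + 1 + r - (m + 1 + i) = r - i by omega,
        show m + 1 + i - (m + 1) = i by omega]
      have hf : (fun e => P (e + (m + 1 + i) + 1)) = (fun e => P (e + i + 1 + (m + 1))) := by
        funext e
        rw [show e + (m + 1 + i) + 1 = e + i + 1 + (m + 1) by omega]
      rw [hf]
      have hch := Nat.choose_mul (n := m + 1 + r) (k := m + 1 + i) (s := m + 1)
        (by omega)
      rw [show m + 1 + r - (m + 1) = r by omega, show m + 1 + i - (m + 1) = i by omega] at hch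
      calc _ = ((m + 1 + r).choose (m + 1 + i) * (m + 1 + i).choose (m + 1)) * subW (m + 1) P *
            subW i (fun e => P (e + (m + 1))) *
            subW (r - i) (fun e => P (e + i + 1 + (m + 1))) := by ring
        _ = _ := by rw [hch]; ring
    · simp
  rw [e1, e2, show m + 1 + (r + 1) - (m + 1) = r + 1 by omega,
    show m + 1 + (r + 1) = (m + 1 + r) + 1 by ring, Nat.choose_succ_succ]
  ring

theorem chainProdAux_eq (n : ℕ) (L : List ℕ) : ∀ prev, (∀ b ∈ L, prev < b ∧ b ≤ n) →
    L.Pairwise (· < ·) → chainProdAux n prev L = subW (n - prev) (fun e => e + prev ∈ L) := by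
  induction L with
  | nil => intro prev _ _; simp [chainProdAux, subW_none]
  | cons b t ih =>
    intro prev h hs
    rw [List.pairwise_cons] at hs
    have hb := h b (by simp)
    rw [chainProdAux, ih b (fun c hc => ⟨hs.1 c hc, (h c (by simp [hc])).2⟩) hs.2,
      subW_mul (n - prev) (b - prev) _ (by omega)
        (by right; rw [show b - prev + prev = b by omega]; simp),
      show n - prev - (b - prev) = n - b by omega]
    have h1 : subW (b - prev) (fun e => e + prev ∈ b :: t) = 1 := by
      rw [← subW_none (b - prev)]
      refine subW_congr _ _ _ fun e he1 he2 => ?_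
      simp only [iff_false, List.mem_cons, not_or]
      refine ⟨by omega, fun hc => ?_⟩
      have := hs.1 _ hc
      omega
    rw [h1, mul_one]
    congr 1
    refine subW_congr _ _ _ fun e he1 he2 => ?_
    rw [show e + (b - prev) + prev = e + b by omega, List.mem_cons]
    constructor
    · exact Or.inr
    · rintro (h | h)
      · omega
      · exact h

theorem chainProd_eq (n : ℕ) (L : List ℕ) (h : ∀ b ∈ L, 0 < b ∧ b ≤ n)
    (hs : L.Pairwise (· < ·)) : chainProd n L = subW n (fun e => e ∈ L) := by
  have := chainProdAux_eq n L 0 h hs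
  simp only [Nat.sub_zero, Nat.add_zero] at this
  rw [← this]
  cases L <;> simp [chainProd, chainProdAux]

theorem omegaD_eq (D : Descent) :
    omegaD D = ∑ t ∈ treesOfGrade D.grade, if (desc t).dset = D.dset then t.alpha else 0 := by
  unfold omegaD
  rw [← Finset.sum_filter, ← finsum_mem_coe_finset]
  refine finsum_congr fun t => ?_
  have : desc t = D ↔ t ∈ ((Finset.filter (fun t => (desc t).dset = D.dset)
      (treesOfGrade D.grade) : Finset PTree) : Set PTree) := by
    rw [Finset.mem_coe, Finset.mem_filter, mem_treesOfGrade, ← desc_grade]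
    constructor
    · rintro rfl; exact ⟨rfl, rfl⟩
    · rintro ⟨h1, h2⟩
      cases hd : desc t
      cases D
      simp_all
  simp only [this]

open Classical in
theorem signed_sum (ℓ : ℕ) (d : Fin ℓ → ℕ) (hd : Function.Injective d) (E : Finset ℕ) :
    (∑ S : Finset (Fin ℓ), (-1 : ℤ) ^ (S.card + ℓ) *
      (if (∀ e ∈ E, e ∈ Finset.image d S) then 1 else 0)) =
      if E = Finset.image d Finset.univ then 1 else 0 := by
  by_cases hE : E ⊆ Finset.image d Finset.univ
  · obtain ⟨A, -, rfl⟩ := Finset.subset_image_iff.1 hE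
    have h1 : ∀ S : Finset (Fin ℓ),
        (∀ e ∈ Finset.image d A, e ∈ Finset.image d S) ↔ A ⊆ S := fun S =>
      Finset.image_subset_image_iff hd
    have h2 : Finset.image d A = Finset.image d Finset.univ ↔ Aᶜ = ∅ := by
      rw [(Finset.image_injective hd).eq_iff, Finset.compl_eq_empty_iff]
    simp only [h1, h2]
    rw [← Finset.sum_powerset_neg_one_pow_card]
    rw [← (Equiv.ofBijective _ (compl_bijective (α := Finset (Fin ℓ)))).sum_comp]
    simp only [mul_ite, mul_one, mul_zero, Equiv.ofBijective_apply]
    rw [← Finset.sum_filter]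
    refine Finset.sum_congr ?_ fun S _ => ?_
    · ext S
      simp only [Finset.mem_filter, Finset.mem_univ, true_and, Finset.mem_powerset]
      exact le_compl_comm
    · have h3 : Sᶜ.card + ℓ = S.card + 2 * Sᶜ.card := by
        have := Finset.card_add_card_compl S
        rw [Fintype.card_fin] at this
        omega
      rw [h3, pow_add, pow_mul]
      simp
  · rw [if_neg (fun h => hE h.le)]
    refine Finset.sum_eq_zero fun S _ => ?_
    rw [if_neg, mul_zero]
    intro h
    exact hE (fun e he => Finset.image_subset_image (Finset.subset_univ S) (h e he))

/-- The weight formula: for `1 ≤ d₁ < ⋯ < d_ℓ ≤ n−1`, the weight of the descent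
`(n, {d₁, …, d_ℓ})` equals
`Σ_{S ⊆ {1,…,ℓ}} (−1)^{|S|+ℓ} C(n, d_{p₁}) ∏_{i=2}^{|S|} C(n − d_{p_{i−1}}, d_{p_i} − d_{p_{i−1}})`,
with the empty subset contributing `(−1)^ℓ`. -/
theorem weight_formula (n ℓ : ℕ) (hn : 1 ≤ n) (hℓ : 1 ≤ ℓ) (d : Fin ℓ → ℕ)
    (hmono : StrictMono d) (hd : ∀ i, 1 ≤ d i ∧ d i ≤ n - 1) :
    (omegaD ⟨n, Finset.image d Finset.univ, by
        intro x hx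
        simp only [Finset.mem_image] at hx
        obtain ⟨i, -, rfl⟩ := hx
        simpa [Finset.mem_Icc] using hd i⟩ : ℤ) =
      ∑ S : Finset (Fin ℓ),
        (-1 : ℤ) ^ (S.card + ℓ) * chainProd n ((S.sort (· ≤ ·)).map d) := by
  classical
  rw [omegaD_eq]
  have h1 : ∀ S : Finset (Fin ℓ), chainProd n ((S.sort (· ≤ ·)).map d) =
      subW n (fun e => e ∈ Finset.image d S) := by
    intro S
    rw [chainProd_eq]
    · refine subW_congr _ _ _ fun e _ _ => ?_
      simp
    · intro b hb
      obtain ⟨i, -, rfl⟩ := List.mem_map.1 hb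
      have := hd i
      omega
    · rw [List.pairwise_map]
      exact (Finset.sortedLT_sort S).pairwise.imp (fun h => hmono h)
  simp only [h1, subW]
  push_cast
  simp only [Finset.mul_sum]
  rw [Finset.sum_comm]
  refine Finset.sum_congr rfl fun t _ => ?_
  have h2 := signed_sum ℓ d hmono.injective (desc t).dset
  calc _ = (if (desc t).dset = Finset.image d Finset.univ then (1 : ℤ) else 0) * t.alpha := by
        split_ifs <;> simp
    _ = _ := by
      rw [← h2, Finset.sum_mul]
      refine Finset.sum_congr rfl fun S _ => ?_
      split_ifs <;> simp
end

section
/- Let n ≥ 1, ℓ ≥ 1 and 1 ≤ d₁ < d₂ < ⋯ < d_ℓ ≤ n−1. Then Σ over all nonempty subsets S = {p₁ < ⋯ < p_j} of {1,…,ℓ} of (−1)^j · C(n − d₁, d_{p₁} − d₁) · ∏_{i=2}^{j} C(n − d_{p_{i−1}}, d_{p_i} − d_{p_{i−1}}) = −1 (an identity in ℤ). -/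
/-- The cancellation identity from Step 5 of the proof of the weight formula: for
`1 ≤ d₁ < d₂ < ⋯ < d_ℓ ≤ n − 1`, summing over all nonempty subsets
`S = {p₁ < ⋯ < p_j}` of `{1, …, ℓ}` the terms
`(−1)^j C(n − d₁, d_{p₁} − d₁) ∏_{i=2}^{j} C(n − d_{p_{i−1}}, d_{p_i} − d_{p_{i−1}})`
gives `−1`. -/
theorem subset_chain_cancellation (n ℓ : ℕ) (hn : 1 ≤ n) (hℓ : 1 ≤ ℓ)
    (d : Fin ℓ → ℕ) (hmono : StrictMono d) (hd : ∀ i, 1 ≤ d i ∧ d i ≤ n - 1) :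
    ∑ S ∈ Finset.univ.filter fun S : Finset (Fin ℓ) => S.Nonempty,
      (-1 : ℤ) ^ S.card * chainProdAux n (d ⟨0, hℓ⟩) ((S.sort (· ≤ ·)).map d) = -1 := by
  set a : Fin ℓ := ⟨0, hℓ⟩ with ha
  have hins : ∀ S : Finset (Fin ℓ), a ∉ S →
      (-1 : ℤ) ^ (insert a S).card *
        chainProdAux n (d a) (((insert a S).sort (· ≤ ·)).map d) =
      -((-1 : ℤ) ^ S.card * chainProdAux n (d a) ((S.sort (· ≤ ·)).map d)) := by
    intro S hS
    rw [Finset.sort_insert (r := (· ≤ ·)) (fun b _ => Fin.mk_le_of_le_val (Nat.zero_le _)) hS,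
      Finset.card_insert_of_notMem hS]
    simp [chainProdAux, pow_succ]
  have htot : ∑ S : Finset (Fin ℓ),
      (-1 : ℤ) ^ S.card * chainProdAux n (d a) ((S.sort (· ≤ ·)).map d) = 0 := by
    rw [← Finset.powerset_univ, ← Finset.insert_erase (Finset.mem_univ a),
      Finset.sum_powerset_insert (Finset.notMem_erase a _), ← Finset.sum_add_distrib]
    refine Finset.sum_eq_zero fun S hS => ?_
    rw [hins S fun h => Finset.notMem_erase a _ (Finset.mem_powerset.1 hS h)]
    ring
  rw [← Finset.sum_filter_add_sum_filter_not _ (fun S : Finset (Fin ℓ) => S.Nonempty)] at htot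
  have he : (Finset.univ.filter fun S : Finset (Fin ℓ) => ¬ S.Nonempty) = {∅} := by
    ext S
    simp
  rw [he, Finset.sum_singleton] at htot
  simp only [Finset.card_empty, Finset.sort_empty, List.map_nil, chainProdAux] at htot
  push_cast at htot
  linarith
end

section
/- Let n ≥ 1 and 1 ≤ d ≤ n−1. Then ω((n, {d})) = C(n, d) − 1, where ω is the descent weight and C(·,·) the binomial coefficient. -/
/-- The right comb of a given grade. -/
def rcomb : ℕ → PTree
  | 0 => .leaf
  | n + 1 => .node .leaf (rcomb n)

theorem rcomb_grade (n : ℕ) : (rcomb n).grade = n := by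
  induction n with
  | zero => rfl
  | succ n ih => simp [rcomb, PTree.grade, ih]

theorem rcomb_alpha (n : ℕ) : (rcomb n).alpha = 1 := by
  induction n with
  | zero => rfl
  | succ n ih => simp [rcomb, PTree.grade, PTree.alpha, ih]

theorem rcomb_dset (n : ℕ) : (desc (rcomb n)).dset = ∅ := by
  induction n with
  | zero => rfl
  | succ n ih => simp [rcomb, desc, dstar, emptyDescent, ih]

theorem grade_zero (t : PTree) (h : t.grade = 0) : t = .leaf := by
  cases t with
  | leaf => rfl
  | node a b => simp [PTree.grade] at h

theorem eq_rcomb (t : PTree) (h : (desc t).dset = ∅) : t = rcomb t.grade := by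
  induction t with
  | leaf => rfl
  | node a b iha ihb =>
    simp only [desc, dstar, Finset.union_eq_empty, Finset.image_eq_empty] at h
    obtain ⟨⟨h1, h2⟩, h3⟩ := h
    have ha : a.grade = 0 := by
      rw [desc_grade] at h3
      split_ifs at h3 with h4
      · simp at h3
      · omega
    have := grade_zero a ha
    subst this
    have e : (PTree.node .leaf b).grade = b.grade + 1 := by simp [PTree.grade]
    rw [e, rcomb, ← ihb h2]

/-- The trees with descent `(d + m + 1, {d})`. -/
def singleTrees (m : ℕ) : ℕ → Finset PTree
  | 0 => ∅
  | d + 1 => insert (.node (rcomb (d + 1)) (rcomb m)) ((singleTrees m d).image (.node .leaf))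

theorem mem_singleTrees (m d : ℕ) (t : PTree) :
    t ∈ singleTrees m d ↔ t.grade = d + m + 1 ∧ (desc t).dset = {d} := by
  induction d generalizing t with
  | zero =>
    simp only [singleTrees, Finset.notMem_empty, false_iff, not_and]
    intro _ h
    have := (desc t).valid (h ▸ Finset.mem_singleton_self 0)
    simp at this
  | succ d ih =>
    simp only [singleTrees, Finset.mem_insert, Finset.mem_image]
    constructor
    · rintro (rfl | ⟨s, hs, rfl⟩)
      · simp [PTree.grade, rcomb_grade, desc, dstar, rcomb_dset, desc_grade]
      · obtain ⟨h1, h2⟩ := (ih s).1 hs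
        refine ⟨by simp [PTree.grade, h1]; omega, ?_⟩
        simp [desc, dstar, emptyDescent, h2]
    · rintro ⟨h1, h2⟩
      cases t with
      | leaf => simp [PTree.grade] at h1
      | node a b =>
        simp only [PTree.grade] at h1
        by_cases ha : a.grade = 0
        · right
          have := grade_zero a ha
          subst this
          refine ⟨b, (ih b).2 ⟨by omega, ?_⟩, rfl⟩
          simp only [desc, dstar, emptyDescent] at h2
          ext x
          have := Finset.ext_iff.1 h2 (x + 1)
          simpa using this
        · left
          simp only [desc, dstar, desc_grade] at h2
          rw [if_pos (by omega)] at h2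
          have k : ∀ x, _ := fun x => Finset.ext_iff.1 h2 x
          simp only [Finset.mem_union, Finset.mem_image, Finset.mem_singleton] at k
          have k1 : a.grade = d + 1 := (k _).1 (Or.inr rfl)
          have k2 : (desc a).dset = ∅ := by
            rw [Finset.eq_empty_iff_forall_notMem]
            intro x hx
            have e := (k x).1 (Or.inl (Or.inl hx))
            have := Finset.mem_Icc.1 ((desc a).valid hx)
            rw [desc_grade] at this
            omega
          have k3 : (desc b).dset = ∅ := by
            rw [Finset.eq_empty_iff_forall_notMem]
            intro x hx
            have e := (k _).1 (Or.inl (Or.inr ⟨x, hx, rfl⟩))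
            omega
          rw [eq_rcomb a k2, eq_rcomb b k3, k1, show b.grade = m by omega]

theorem sum_singleTrees (m d : ℕ) :
    ∑ t ∈ singleTrees m d, t.alpha + 1 = Nat.choose (d + m + 1) d := by
  induction d with
  | zero => simp [singleTrees]
  | succ d ih =>
    rw [singleTrees, Finset.sum_insert, Finset.sum_image]
    · simp only [PTree.alpha, PTree.grade, rcomb_grade, rcomb_alpha]
      simp only [Nat.zero_add, Nat.choose_zero_right, one_mul, mul_one]
      rw [add_assoc, ih, show d + 1 + m + 1 = (d + m + 1) + 1 by ring, Nat.choose_succ_succ,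
        show d + 1 + m = d + m + 1 by ring, add_comm]
    · intro x _ y _ h
      simpa using h
    · simp [rcomb]

/-- The single-descent weight: for `1 ≤ d ≤ n−1`, `ω((n, {d})) = C(n, d) − 1`. -/
theorem weight_single_descent (n d : ℕ) (hn : 1 ≤ n) (hd1 : 1 ≤ d) (hd2 : d ≤ n - 1) :
    (omegaD ⟨n, {d}, by
        intro x hx
        rw [Finset.mem_singleton] at hx
        subst hx
        rw [Finset.mem_Icc]
        exact ⟨hd1, hd2⟩⟩ : ℤ) = Nat.choose n d - 1 := by
  obtain ⟨m, rfl⟩ : ∃ m, n = d + m + 1 := ⟨n - d - 1, by omega⟩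
  rw [← sum_singleTrees m d, omegaD]
  rw [finsum_cond_eq_sum_of_cond_iff PTree.alpha (t := singleTrees m d) (p := fun τ => desc τ = _)]
  · push_cast
    ring
  · intro t _
    simp only [mem_singleTrees, ← desc_grade]
    constructor
    · intro h
      have h' : desc t = _ := h
      rw [h']
      exact ⟨rfl, rfl⟩
    · rintro ⟨h1, h2⟩
      change desc t = _
      generalize desc t = e at h1 h2
      obtain ⟨g, s, v⟩ := e
      dsimp at h1 h2
      subst h1; subst h2; rfl
end

section
/- For every n ∈ ℕ and every D ⊆ {1,…,n−1}, there exists a planar binary rooted tree τ with desc(τ) = (n, D). -/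
theorem desc_surj_aux : ∀ (n : ℕ) (D : Finset ℕ), D ⊆ Finset.Icc 1 (n - 1) →
    ∃ τ : PTree, (desc τ).grade = n ∧ (desc τ).dset = D := by
  intro n
  induction n using Nat.strong_induction_on with
  | _ n ih =>
    intro D hD
    rcases Nat.eq_zero_or_pos n with rfl | hn
    · refine ⟨.leaf, rfl, ?_⟩
      have : D = ∅ := by simpa using hD
      rw [this]; rfl
    · rcases D.eq_empty_or_nonempty with rfl | hne
      · obtain ⟨τ, h1, h2⟩ := ih (n - 1) (by omega) ∅ (by simp)
        refine ⟨.node .leaf τ, ?_, ?_⟩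
        · simp only [desc, dstar, emptyDescent, h1]; omega
        · simp [desc, dstar, emptyDescent, h2]
      · have hm := D.max'_mem hne
        have hle : ∀ x ∈ D, x ≤ D.max' hne := fun x hx => D.le_max' x hx
        generalize D.max' hne = m at hm hle
        have hmI := Finset.mem_Icc.mp (hD hm)
        obtain ⟨σ, s1, s2⟩ := ih m (by omega) (D.erase m) (by
          intro x hx
          obtain ⟨hx1, hx2⟩ := Finset.mem_erase.mp hx
          have a := hle x hx2
          have b := Finset.mem_Icc.mp (hD hx2)
          exact Finset.mem_Icc.mpr (by omega))
        obtain ⟨τ, t1, t2⟩ := ih (n - 1 - m) (by omega) ∅ (by simp)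
        refine ⟨.node σ τ, ?_, ?_⟩
        · simp only [desc, dstar, s1, t1]; omega
        · simp only [desc, dstar, s1, s2, t2, if_pos hmI.1]
          ext x
          simp only [Finset.mem_union, Finset.mem_erase, Finset.image_empty,
            Finset.notMem_empty, Finset.mem_singleton]
          by_cases h : x = m
          · subst h; simp [hm]
          · simp [h]

/-- Surjectivity of the descent map: every descent `(n, D)` with `D ⊆ {1,…,n−1}` is the
descent of some planar binary rooted tree. -/
theorem desc_surjective (n : ℕ) (D : Finset ℕ) (hD : D ⊆ Finset.Icc 1 (n - 1)) :
    ∃ τ : PTree, desc τ = ⟨n, D, hD⟩ := by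
  obtain ⟨τ, h1, h2⟩ := desc_surj_aux n D hD
  refine ⟨τ, ?_⟩
  generalize desc τ = d at h1 h2
  obtain ⟨g, s, v⟩ := d
  dsimp at h1 h2
  subst h1; subst h2; rfl
end

section
/- Let n ≥ 1 and work in the free ℝ-algebra on three generators 𝔩, 𝔤, 𝔯. For D ⊆ {1,…,n−1} define Φ(D) := ∏_{j=1}^{n} f_j (product in the given order), where f_j := F̂(b_{j−1}, b_j) with b₀ := 0, b_n := 1, b_i := 1 if i ∈ D and b_i := 0 otherwise for 1 ≤ i ≤ n−1, and F̂(0,0) = 𝔩+𝔤, F̂(0,1) = 𝔤, F̂(1,0) = 𝔩+𝔤+𝔯, F̂(1,1) = 𝔯+𝔤. Then Σ_{D ⊆ {1,…,n−1}} (−1)^{|D|} Φ(D) = Σ_{k=0}^{n−1} (−1)^k 𝔩^{n−1−k} 𝔤 𝔯^{k}. -/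
/-- The boundary word of a descent set `D` of grade `n`: `b 0 = false`, `b n = true`, and
`b i = (i ∈ D)` for `1 ≤ i ≤ n − 1`. -/
def bfun (n : ℕ) (D : Finset ℕ) (i : ℕ) : Bool :=
  if i = n then true else decide (i ∈ D)

/-- The local rule `F̂(0,0) = 𝔩+𝔤`, `F̂(0,1) = 𝔤`, `F̂(1,0) = 𝔩+𝔤+𝔯`, `F̂(1,1) = 𝔯+𝔤`, with
values in the free `ℝ`-algebra on the generators `𝔩 = ι 0`, `𝔤 = ι 1`, `𝔯 = ι 2`. -/
noncomputable def Fhat : Bool → Bool → FreeAlgebra ℝ (Fin 3)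
  | false, false => FreeAlgebra.ι ℝ (0 : Fin 3) + FreeAlgebra.ι ℝ (1 : Fin 3)
  | false, true => FreeAlgebra.ι ℝ (1 : Fin 3)
  | true, false =>
      FreeAlgebra.ι ℝ (0 : Fin 3) + FreeAlgebra.ι ℝ (1 : Fin 3) + FreeAlgebra.ι ℝ (2 : Fin 3)
  | true, true => FreeAlgebra.ι ℝ (2 : Fin 3) + FreeAlgebra.ι ℝ (1 : Fin 3)

/-- The expanded lgr-code `Φ(D)` of the descent set `D` of grade `n`: the ordered product
`∏_{j=1}^{n} F̂(b_{j−1}, b_j)` in the free algebra. -/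
noncomputable def Phi (n : ℕ) (D : Finset ℕ) : FreeAlgebra ℝ (Fin 3) :=
  ((List.range n).map fun j => Fhat (bfun n D j) (bfun n D (j + 1))).prod

/-- Ordered product of the first `m` factors, using plain membership bits. -/
noncomputable def Qpre (m : ℕ) (D : Finset ℕ) : FreeAlgebra ℝ (Fin 3) :=
  ((List.range m).map fun j => Fhat (decide (j ∈ D)) (decide (j + 1 ∈ D))).prod

/-- Signed transfer sum with prescribed last bit `c`. -/
noncomputable def Tsum (m : ℕ) (c : Bool) : FreeAlgebra ℝ (Fin 3) :=
  ∑ D ∈ (Finset.Icc 1 m).powerset, ((-1 : ℝ) ^ D.card) • (Qpre m D * Fhat (decide (m ∈ D)) c)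

theorem Qpre_succ (m : ℕ) (D : Finset ℕ) :
    Qpre (m + 1) D = Qpre m D * Fhat (decide (m ∈ D)) (decide (m + 1 ∈ D)) := by
  simp [Qpre, List.range_succ]

theorem Qpre_insert (m : ℕ) (D : Finset ℕ) : Qpre m (insert (m + 1) D) = Qpre m D := by
  unfold Qpre
  congr 1
  apply List.map_congr_left
  intro j hj
  have hj' : j < m := List.mem_range.mp hj
  have h1 : j ≠ m + 1 := by omega
  have h2 : j ≠ m := by omega
  simp [Finset.mem_insert, h1, h2]

theorem Phi_succ (m : ℕ) (D : Finset ℕ) :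
    Phi (m + 1) D = Qpre m D * Fhat (decide (m ∈ D)) true := by
  unfold Phi Qpre
  rw [List.range_succ, List.map_append, List.prod_append]
  congr 1
  · congr 1
    apply List.map_congr_left
    intro j hj
    have hj' : j < m := List.mem_range.mp hj
    have h1 : j ≠ m + 1 := by omega
    have h2 : j ≠ m := by omega
    simp [bfun, h1, h2]
  · simp [bfun]

theorem Tsum_succ (m : ℕ) (c : Bool) :
    Tsum (m + 1) c = Tsum m false * Fhat false c - Tsum m true * Fhat true c := by
  have hI : Finset.Icc 1 (m + 1) = insert (m + 1) (Finset.Icc 1 m) := by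
    ext x; simp only [Finset.mem_Icc, Finset.mem_insert]; omega
  unfold Tsum
  rw [hI, Finset.sum_powerset_insert (by simp), sub_eq_add_neg, Finset.sum_mul, Finset.sum_mul,
    ← Finset.sum_neg_distrib]
  congr 1
  · apply Finset.sum_congr rfl
    intro D hD
    have hn : m + 1 ∉ D := fun h => by
      have := Finset.mem_Icc.mp (Finset.mem_powerset.mp hD h); omega
    simp [Qpre_succ, hn]
  · apply Finset.sum_congr rfl
    intro D hD
    have hn : m + 1 ∉ D := fun h => by
      have := Finset.mem_Icc.mp (Finset.mem_powerset.mp hD h); omega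
    simp [Qpre_succ, Qpre_insert, hn, Finset.card_insert_of_notMem, pow_succ]

theorem Tsum_zero (c : Bool) : Tsum 0 c = Fhat false c := by
  simp [Tsum, Qpre]

theorem Tsum_diff (m : ℕ) :
    Tsum m false = Tsum m true + FreeAlgebra.ι ℝ (0 : Fin 3) ^ (m + 1) := by
  induction m with
  | zero => simp only [Tsum_zero, Fhat]; noncomm_ring
  | succ m ih =>
    rw [Tsum_succ, Tsum_succ, ih, pow_succ _ (m + 1)]
    simp only [Fhat]
    noncomm_ring

theorem Tsum_true (m : ℕ) :
    Tsum m true = ∑ k ∈ Finset.range (m + 1),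
        ((-1 : ℝ) ^ k) •
          (FreeAlgebra.ι ℝ (0 : Fin 3) ^ (m - k) * FreeAlgebra.ι ℝ (1 : Fin 3) *
            FreeAlgebra.ι ℝ (2 : Fin 3) ^ k) := by
  induction m with
  | zero => simp [Tsum_zero, Fhat]
  | succ m ih =>
    have h : Tsum (m + 1) true = -(Tsum m true * FreeAlgebra.ι ℝ (2 : Fin 3)) +
        FreeAlgebra.ι ℝ (0 : Fin 3) ^ (m + 1) * FreeAlgebra.ι ℝ (1 : Fin 3) := by
      rw [Tsum_succ, Tsum_diff]
      simp only [Fhat, mul_add, add_mul]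
      abel
    rw [h, ih, Finset.sum_range_succ' _ (m + 1), Finset.sum_mul, ← Finset.sum_neg_distrib]
    congr 1
    · apply Finset.sum_congr rfl
      intro k _
      simp [pow_succ, mul_assoc]
    · simp

/-- The Sato coefficient via lgr-codes:
`Σ_{D ⊆ {1,…,n−1}} (−1)^{|D|} Φ(D) = Σ_{k=0}^{n−1} (−1)^k 𝔩^{n−1−k} 𝔤 𝔯^k`. -/
theorem sato_coefficient_lgr (n : ℕ) (hn : 1 ≤ n) :
    ∑ D ∈ (Finset.Icc 1 (n - 1)).powerset, ((-1 : ℝ) ^ D.card) • Phi n D =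
      ∑ k ∈ Finset.range n,
        ((-1 : ℝ) ^ k) •
          (FreeAlgebra.ι ℝ (0 : Fin 3) ^ (n - 1 - k) * FreeAlgebra.ι ℝ (1 : Fin 3) *
            FreeAlgebra.ι ℝ (2 : Fin 3) ^ k) := by
  obtain ⟨m, rfl⟩ : ∃ m, n = m + 1 := ⟨n - 1, by omega⟩
  simp only [Nat.add_sub_cancel, Phi_succ]
  exact Tsum_true m
end

section
/- Fix n ≥ 1. In the free ℝ-module on descents, with the grafting product ⋆ extended bilinearly and iterated products parenthesized left to right, define 𝔭_j := Σ_{‖𝔡‖=j} ω(𝔡) • 𝔡 and define b_{n−k} recursively for k = 2, …, n+1 by b_{n−2} := −C(n,1) • 𝔭₁ and b_{n−k} := −C(n, k−1) • 𝔭_{k−1} − Σ_{ℓ=2}^{k−1} C(n−ℓ, k−1−ℓ) • (b_{n−ℓ} ⋆ 𝔭_{k−1−ℓ}) for 3 ≤ k ≤ n+1. Then for every 2 ≤ k ≤ n+1, b_{n−k} = Σ over all compositions c = (c₁,…,c_ℓ) of k with c₁ ≥ 2 of (−1)^ℓ γ_n(c) • ( ((𝔭_{c₁−1} ⋆ 𝔭_{c₂−1})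 ⋆ ⋯ ) ⋆ 𝔭_{c_ℓ−1} ), where γ_n(c) := ∏_{i=1}^{ℓ} C(n − c₁ − ⋯ − c_{i−1}, c_i − 1). -/
/-- The bilinear extension of the grafting product to the free `ℝ`-module on descents. -/
noncomputable def graft2 (x y : Descent →₀ ℝ) : Descent →₀ ℝ :=
  x.sum fun d1 c1 => y.sum fun d2 c2 => Finsupp.single (dstar d1 d2) (c1 * c2)

/-- `𝔭_j`, the weighted sum of all descents of grade `j`, in the free `ℝ`-module on descents. -/
noncomputable def pD (j : ℕ) : Descent →₀ ℝ :=
  ∑ d ∈ descentsOfGrade j, Finsupp.single d (omegaD d : ℝ)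

/-- The Sato coefficients `b_{n-k}` (indexed by `k`), defined recursively. -/
noncomputable def satoB (n : ℕ) : ℕ → (Descent →₀ ℝ)
  | k =>
    -((n.choose (k - 1) : ℝ) • pD (k - 1)) -
      ∑ ℓ ∈ (Finset.Icc 2 (k - 1)).attach,
        (((n - ℓ.1).choose (k - 1 - ℓ.1) : ℝ)) • graft2 (satoB n ℓ.1) (pD (k - 1 - ℓ.1))
termination_by k => k
decreasing_by
  have h := Finset.mem_Icc.mp ℓ.2
  omega

/-- Left-to-right grafting product of a list of elements of the free module on descents. -/
noncomputable def graftFoldl : List (Descent →₀ ℝ) → (Descent →₀ ℝ)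
  | [] => 0
  | h :: t => t.foldl graft2 h

/-- `γ_n(c) = ∏ᵢ C(n − c₁ − ⋯ − c_{i−1}, cᵢ − 1)` for a composition `c`. -/
def gammaN (n : ℕ) {k : ℕ} (c : Composition k) : ℕ :=
  ∏ i ∈ Finset.range c.length,
    Nat.choose (n - (c.blocks.take i).sum) (c.blocks.getD i 0 - 1)

/-- The coefficient `∏ᵢ C(n − ‖𝔡₀‖ − ⋯ − ‖𝔡_{i−1}‖ − i, ‖𝔡ᵢ‖)` attached to a tuple of descents. -/
def satoCoef (n : ℕ) (M : List Descent) : ℕ :=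
  ∏ i ∈ Finset.range M.length,
    Nat.choose (n - ((M.take i).map Descent.grade).sum - i) ((M.getD i emptyDescent).grade)

/-- `s_n(𝔡)`: the alternating sum, over all left-nested factorizations of `𝔡` whose first
factor is not `∅₀`, of the Sato coefficient times the product of the descent weights. -/
noncomputable def sN (n : ℕ) (d : Descent) : ℤ :=
  ∑ᶠ (m : ℕ), (-1 : ℤ) ^ m *
    ∑ᶠ (p : Descent × List Descent)
      (_ : p.2.length = m ∧ p.1 ≠ emptyDescent ∧ p.2.foldl dstar p.1 = d),
      ((satoCoef n (p.1 :: p.2) * ((p.1 :: p.2).map omegaD).prod : ℕ) : ℤ)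

namespace SatoAux

noncomputable def graftLin : (Descent →₀ ℝ) →ₗ[ℝ] (Descent →₀ ℝ) →ₗ[ℝ] (Descent →₀ ℝ) :=
  Finsupp.lsum ℝ fun d1 => LinearMap.toSpanSingleton ℝ _
    (Finsupp.lsum ℝ fun d2 => Finsupp.lsingle (dstar d1 d2))

lemma graft2_eq (x y : Descent →₀ ℝ) : graft2 x y = graftLin x y := by
  unfold graft2 graftLin
  simp only [Finsupp.lsum_apply, Finsupp.sum, LinearMap.sum_apply,
    LinearMap.toSpanSingleton_apply, LinearMap.smul_apply, Finset.smul_sum,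
    Finsupp.lsingle_apply, Finsupp.smul_single, smul_eq_mul]

def gammaL (n : ℕ) (L : List ℕ) : ℕ :=
  ∏ i ∈ Finset.range L.length, Nat.choose (n - (L.take i).sum) (L.getD i 0 - 1)

lemma gammaL_append (n : ℕ) (L : List ℕ) (a : ℕ) :
    gammaL n (L ++ [a]) = gammaL n L * Nat.choose (n - L.sum) (a - 1) := by
  unfold gammaL
  rw [List.length_append, List.length_singleton, Finset.prod_range_succ]
  congr 1
  · apply Finset.prod_congr rfl
    intro i hi
    have hi := Finset.mem_range.mp hi
    rw [List.take_append_of_le_length hi.le, List.getD_append _ _ _ _ hi]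
  · simp [List.getD_append_right]

noncomputable def F (n : ℕ) (L : List ℕ) : Descent →₀ ℝ :=
  ((-1 : ℝ) ^ L.length * (gammaL n L : ℝ)) • graftFoldl (L.map fun ci => pD (ci - 1))

lemma F_append (n : ℕ) (L : List ℕ) (hL : L ≠ []) (a : ℕ) :
    F n (L ++ [a]) =
      -(((n - L.sum).choose (a - 1) : ℝ) • graft2 (F n L) (pD (a - 1))) := by
  have h : graftFoldl ((L ++ [a]).map fun ci => pD (ci - 1)) =
      graft2 (graftFoldl (L.map fun ci => pD (ci - 1))) (pD (a - 1)) := by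
    cases L with
    | nil => exact absurd rfl hL
    | cons b t => simp [graftFoldl]
  unfold F
  rw [h, gammaL_append, graft2_eq, graft2_eq, map_smul, LinearMap.smul_apply, smul_smul,
    ← neg_smul]
  congr 1
  rw [List.length_append, List.length_singleton, pow_succ]
  push_cast
  ring

noncomputable def S (k : ℕ) : Finset (List ℕ) :=
  (Finset.univ.filter fun c : Composition k => 2 ≤ c.blocks.headI).image Composition.blocks

lemma mem_S {k : ℕ} {L : List ℕ} :
    L ∈ S k ↔ (∀ i ∈ L, 0 < i) ∧ L.sum = k ∧ 2 ≤ L.headI := by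
  simp only [S, Finset.mem_image, Finset.mem_filter, Finset.mem_univ, true_and]
  constructor
  · rintro ⟨c, hc, rfl⟩
    exact ⟨fun i hi => c.blocks_pos hi, c.blocks_sum, hc⟩
  · rintro ⟨h1, h2, h3⟩
    exact ⟨⟨L, fun {i} hi => h1 i hi, h2⟩, h3, rfl⟩

lemma headI_le_sum (L : List ℕ) : L.headI ≤ L.sum := by
  cases L <;> simp

lemma headI_append (L : List ℕ) (hL : L ≠ []) (a : ℕ) : (L ++ [a]).headI = L.headI := by
  cases L with
  | nil => exact absurd rfl hL
  | cons b t => rfl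

lemma ne_nil_of_headI {L : List ℕ} (h : 2 ≤ L.headI) : L ≠ [] := by
  rintro rfl
  simp at h

lemma sum_S (n k : ℕ) (hk : 2 ≤ k) :
    ∑ L ∈ S k, F n L = F n [k] +
      ∑ ℓ ∈ Finset.Icc 2 (k - 1), ∑ L ∈ S ℓ, F n (L ++ [k - ℓ]) := by
  have hmem : [k] ∈ S k := by
    rw [mem_S]
    simp
    omega
  rw [← Finset.add_sum_erase _ _ hmem, Finset.sum_sigma']
  congr 1
  symm
  refine Finset.sum_bij' (fun p _ => p.2 ++ [k - p.1])
    (fun L _ => ⟨L.dropLast.sum, L.dropLast⟩) ?_ ?_ ?_ ?_ ?_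
  · rintro ⟨ℓ, L⟩ h
    simp only [Finset.mem_sigma, Finset.mem_Icc, mem_S] at h
    obtain ⟨⟨h1, h2⟩, h3, h4, h5⟩ := h
    have hL := ne_nil_of_headI h5
    rw [Finset.mem_erase, mem_S]
    refine ⟨?_, ?_, ?_, ?_⟩
    · intro h
      have := congrArg List.length h
      simp at this
      exact hL this
    · intro i hi
      rcases List.mem_append.mp hi with hi | hi
      · exact h3 i hi
      · rw [List.mem_singleton] at hi
        dsimp only at hi
        omega
    · simp [h4]
      omega
    · rw [headI_append _ hL]
      exact h5
  · intro L h
    rw [Finset.mem_erase, mem_S] at h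
    obtain ⟨h1, h2, h3, h4⟩ := h
    have hL := ne_nil_of_headI h4
    obtain ⟨M, a, rfl⟩ : ∃ M a, L = M ++ [a] :=
      ⟨L.dropLast, L.getLast hL, (List.dropLast_append_getLast hL).symm⟩
    have hM : M ≠ [] := by
      rintro rfl
      apply h1
      simp at h3 ⊢
      exact h3
    rw [headI_append _ hM] at h4
    have := headI_le_sum M
    have ha := h2 a (by simp)
    simp only [List.sum_append, List.sum_singleton] at h3
    simp only [Finset.mem_sigma, Finset.mem_Icc, mem_S, List.dropLast_concat]
    refine ⟨⟨by omega, by omega⟩, fun i hi => h2 i (by simp [hi]), trivial, h4⟩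
  · rintro ⟨ℓ, L⟩ h
    simp only [Finset.mem_sigma, Finset.mem_Icc, mem_S] at h
    obtain ⟨⟨h1, h2⟩, h3, h4, h5⟩ := h
    subst h4
    simp
  · intro L h
    rw [Finset.mem_erase, mem_S] at h
    obtain ⟨h1, h2, h3, h4⟩ := h
    have hL := ne_nil_of_headI h4
    obtain ⟨M, a, rfl⟩ : ∃ M a, L = M ++ [a] :=
      ⟨L.dropLast, L.getLast hL, (List.dropLast_append_getLast hL).symm⟩
    simp only [List.sum_append, List.sum_singleton] at h3
    simp only [List.dropLast_concat]
    congr 2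
    omega
  · intros
    rfl

lemma satoB_eq (n k : ℕ) (hk : 2 ≤ k) : satoB n k = ∑ L ∈ S k, F n L := by
  induction k using Nat.strong_induction_on with
  | _ k ih =>
    rw [sum_S n k hk, satoB, sub_eq_add_neg]
    congr 1
    · simp [F, gammaL, graftFoldl]
    · rw [Finset.sum_attach (Finset.Icc 2 (k - 1)) (fun ℓ =>
        (((n - ℓ).choose (k - 1 - ℓ) : ℝ)) • graft2 (satoB n ℓ) (pD (k - 1 - ℓ))),
        ← Finset.sum_neg_distrib]
      apply Finset.sum_congr rfl
      intro ℓ hℓ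
      rw [Finset.mem_Icc] at hℓ
      rw [ih ℓ (by omega) hℓ.1, graft2_eq, map_sum, LinearMap.sum_apply, Finset.smul_sum,
        ← Finset.sum_neg_distrib]
      apply Finset.sum_congr rfl
      intro L hL
      rw [mem_S] at hL
      rw [F_append n L (ne_nil_of_headI hL.2.2), hL.2.1, graft2_eq,
        show k - 1 - ℓ = k - ℓ - 1 by omega]

end SatoAux

/-- The Sato coefficients in the descent algebra are indexed by compositions not starting
with `1`: for `2 ≤ k ≤ n+1`,
`b_{n−k} = Σ_{c = (c₁,…,c_ℓ) ⊨ k, c₁ ≥ 2} (−1)^ℓ γ_n(c) • (((𝔭_{c₁−1} ⋆ 𝔭_{c₂−1}) ⋆ ⋯) ⋆ 𝔭_{c_ℓ−1})`. -/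
theorem sato_coefficients_compositions (n : ℕ) (hn : 1 ≤ n) (k : ℕ) (hk2 : 2 ≤ k)
    (hkn : k ≤ n + 1) :
    satoB n k =
      ∑ c ∈ Finset.univ.filter fun c : Composition k => 2 ≤ c.blocks.headI,
        ((-1 : ℝ) ^ c.length * (gammaN n c : ℝ)) •
          graftFoldl (c.blocks.map fun ci => pD (ci - 1)) := by
  rw [SatoAux.satoB_eq n k hk2, SatoAux.S, Finset.sum_image]
  · rfl
  · intro a _ b _ h
    exact Composition.ext h
end

section
/- Fix n ≥ 1 and define the Sato coefficients b_{n−k} (k = 2,…,n+1) in the free ℝ-module on descents by the recursion b_{n−2} := −C(n,1) • 𝔭₁ and b_{n−k} := −C(n, k−1) • 𝔭_{k−1} − Σ_{ℓ=2}^{k−1} C(n−ℓ, k−1−ℓ) • (b_{n−ℓ} ⋆ 𝔭_{k−1−ℓ}). For a descent 𝔡 define s_n(𝔡) := Σ_{m ≥ 0} (−1)^m Σ over all left-nested factorizations (𝔡₀, 𝔡₁, …, 𝔡_m) of 𝔡 with 𝔡₀ ≠ ∅₀ of ( ∏_{i=0}^{m} C(n − ‖𝔡₀‖ − ⋯ −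 ‖𝔡_{i−1}‖ − i, ‖𝔡_i‖) ) · ( ∏_{i=0}^{m} ω(𝔡_i) ). Then for every 2 ≤ k ≤ n+1, b_{n−k} = −Σ_{𝔡 : ‖𝔡‖ = k−1} s_n(𝔡) • 𝔡. -/
theorem mem_dog {n : ℕ} {d : Descent} : d ∈ descentsOfGrade n ↔ d.grade = n := by
  unfold descentsOfGrade
  simp only [Finset.mem_image, Finset.mem_attach, true_and, Subtype.exists, Finset.mem_powerset]
  constructor
  · rintro ⟨a, ha, rfl⟩; rfl
  · rintro rfl
    exact ⟨d.dset, d.valid, rfl⟩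

theorem grade_zero_iff (d : Descent) : d = emptyDescent ↔ d.grade = 0 := by
  constructor
  · rintro rfl; rfl
  · intro h
    obtain ⟨g, s, v⟩ := d
    dsimp at h
    subst h
    have : s = ∅ := by
      rw [← Finset.subset_empty]; simpa using v
    subst this
    rfl

theorem grade_dstar (a b : Descent) : (dstar a b).grade = a.grade + b.grade + 1 := rfl

/-- Pairs `(e,f)` with `e ⋆ f = d` and `e` of positive grade. -/
def dpairs (d : Descent) : Finset (Descent × Descent) :=
  ((Finset.range (d.grade + 1)).biUnion descentsOfGrade ×ˢ
    (Finset.range (d.grade + 1)).biUnion descentsOfGrade).filter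
    fun p => 1 ≤ p.1.grade ∧ dstar p.1 p.2 = d

theorem mem_dpairs {d : Descent} {p : Descent × Descent} :
    p ∈ dpairs d ↔ 1 ≤ p.1.grade ∧ dstar p.1 p.2 = d := by
  unfold dpairs
  simp only [Finset.mem_filter, Finset.mem_product, Finset.mem_biUnion, Finset.mem_range, mem_dog]
  constructor
  · exact fun h => h.2
  · rintro ⟨h1, h2⟩
    refine ⟨?_, h1, h2⟩
    have := congrArg Descent.grade h2
    rw [grade_dstar] at this
    exact ⟨⟨_, by omega, rfl⟩, ⟨_, by omega, rfl⟩⟩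

/-- Left-nested factorizations with `m + 1` parts. -/
def facs : ℕ → Descent → Finset (Descent × List Descent)
  | 0, d => if d = emptyDescent then ∅ else {(d, [])}
  | m + 1, d => (dpairs d).biUnion fun q => (facs m q.1).image fun p => (p.1, p.2 ++ [q.2])

theorem grade_foldl (l : List Descent) (a : Descent) :
    (l.foldl dstar a).grade = a.grade + (l.map Descent.grade).sum + l.length := by
  induction l generalizing a with
  | nil => simp
  | cons b l ih => rw [List.foldl_cons, ih, grade_dstar]; simp; omega

theorem mem_facs (m : ℕ) (d : Descent) (p : Descent × List Descent) :
    p ∈ facs m d ↔ (p.2.length = m ∧ p.1 ≠ emptyDescent ∧ p.2.foldl dstar p.1 = d) := by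
  induction m generalizing d p with
  | zero =>
    obtain ⟨a, l⟩ := p
    simp only [facs]
    constructor
    · intro h
      split_ifs at h with h0
      · simp at h
      · simp only [Finset.mem_singleton, Prod.mk.injEq] at h
        obtain ⟨rfl, rfl⟩ := h
        exact ⟨rfl, h0, rfl⟩
    · rintro ⟨h1, h2, h3⟩
      obtain rfl := List.eq_nil_of_length_eq_zero h1
      simp only [List.foldl_nil] at h3
      subst h3
      rw [if_neg h2]; simp
  | succ m ih =>
    obtain ⟨a, l⟩ := p
    simp only [facs, Finset.mem_biUnion, Finset.mem_image, mem_dpairs, ih]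
    constructor
    · rintro ⟨⟨e, f⟩, ⟨h1, h2⟩, ⟨b, l'⟩, ⟨h3, h4, h5⟩, h6⟩
      simp only [Prod.mk.injEq] at h6 h1 h2 h3 h4 h5
      obtain ⟨rfl, rfl⟩ := h6
      refine ⟨by simp [h3], h4, ?_⟩
      simp [h5, h2]
    · rintro ⟨h1, h2, h3⟩
      dsimp at h1 h2 h3
      rcases List.eq_nil_or_concat l with rfl | ⟨l', f, rfl⟩
      · simp at h1
      · simp only [List.concat_eq_append, List.foldl_append, List.foldl_cons, List.foldl_nil,
          List.length_append, List.length_cons, List.length_nil] at h1 h3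
        refine ⟨(l'.foldl dstar a, f), ⟨?_, h3⟩, (a, l'), ⟨by simpa using h1, h2, rfl⟩, by simp⟩
        rw [grade_foldl]
        have := mt (grade_zero_iff a).2 h2
        omega

noncomputable def facW (n : ℕ) (p : Descent × List Descent) : ℤ :=
  ((satoCoef n (p.1 :: p.2) * ((p.1 :: p.2).map omegaD).prod : ℕ) : ℤ)

noncomputable def facT (n m : ℕ) (d : Descent) : ℤ := ∑ p ∈ facs m d, facW n p

theorem satoCoef_append (n : ℕ) (M : List Descent) (f : Descent) :
    satoCoef n (M ++ [f]) =
      satoCoef n M * Nat.choose (n - (M.map Descent.grade).sum - M.length) f.grade := by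
  unfold satoCoef
  rw [List.length_append, List.length_singleton, Finset.prod_range_succ]
  congr 1
  · refine Finset.prod_congr rfl fun i hi => ?_
    have hi := Finset.mem_range.1 hi
    rw [List.take_append_of_le_length hi.le, List.getD_append _ _ _ _ hi]
  · simp

theorem facT_succ (n m : ℕ) (d : Descent) :
    facT n (m + 1) d = ∑ q ∈ dpairs d,
      ((n - (q.1.grade + 1)).choose q.2.grade : ℤ) * facT n m q.1 * (omegaD q.2 : ℤ) := by
  unfold facT
  simp only [facs]
  rw [Finset.sum_biUnion]
  · refine Finset.sum_congr rfl fun q hq => ?_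
    rw [Finset.sum_image]
    · rw [Finset.mul_sum, Finset.sum_mul]
      refine Finset.sum_congr rfl fun p hp => ?_
      rw [mem_facs] at hp
      obtain ⟨h1, h2, h3⟩ := hp
      have hg : q.1.grade = _ := h3 ▸ grade_foldl p.2 p.1
      unfold facW
      dsimp only
      rw [← List.cons_append, satoCoef_append, List.map_append, List.prod_append]
      have : n - ((p.1 :: p.2).map Descent.grade).sum - (p.1 :: p.2).length
          = n - (q.1.grade + 1) := by
        simp only [List.map_cons, List.sum_cons, List.length_cons]; omega
      rw [this]
      push_cast
      simp
      ring
    · rintro ⟨a, l⟩ _ ⟨b, l'⟩ _ h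
      simpa using h
  · intro q hq q' hq' hne
    rw [Function.onFun, Finset.disjoint_left]
    intro x hx hx'
    simp only [Finset.mem_image, mem_facs] at hx hx'
    obtain ⟨p, ⟨-, -, h3⟩, rfl⟩ := hx
    obtain ⟨p', ⟨-, -, h3'⟩, h⟩ := hx'
    simp only [Prod.mk.injEq] at h
    obtain ⟨h4, h5⟩ := h
    have h6 := List.append_inj' h5 rfl
    apply hne
    ext1
    · rw [← h3, ← h3', h4, h6.1]
    · simpa using h6.2.symm

theorem facT_zero (n : ℕ) (d : Descent) (hd : 1 ≤ d.grade) :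
    facT n 0 d = (n.choose d.grade : ℤ) * (omegaD d : ℤ) := by
  have : d ≠ emptyDescent := by rw [Ne, grade_zero_iff]; omega
  simp [facT, facs, this, facW, satoCoef]

theorem facT_big (n m : ℕ) (d : Descent) (h : d.grade < m) : facT n m d = 0 := by
  unfold facT
  have : facs m d = ∅ := by
    rw [Finset.eq_empty_iff_forall_notMem]
    intro p hp
    obtain ⟨h1, h2, h3⟩ := (mem_facs _ _ _).1 hp
    have := grade_foldl p.2 p.1
    rw [h3] at this
    omega
  rw [this, Finset.sum_empty]

theorem sN_eq (n N : ℕ) (d : Descent) (hN : d.grade < N) :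
    sN n d = ∑ m ∈ Finset.range N, (-1 : ℤ) ^ m * facT n m d := by
  have h1 : sN n d = ∑ᶠ m : ℕ, (-1 : ℤ) ^ m * facT n m d := by
    unfold sN
    refine finsum_congr fun m => ?_
    congr 1
    unfold facT
    rw [← finsum_mem_finset_eq_sum]
    refine finsum_congr fun p => ?_
    simp only [mem_facs]
    rfl
  rw [h1]
  refine finsum_eq_sum_of_support_subset _ ?_
  intro m hm
  rw [Function.mem_support] at hm
  by_contra hc
  simp only [Finset.coe_range, Set.mem_Iio, not_lt] at hc
  exact hm (by rw [facT_big n m d (by omega), mul_zero])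

theorem sN_rec (n : ℕ) (d : Descent) (hd : 1 ≤ d.grade) :
    sN n d = (n.choose d.grade : ℤ) * (omegaD d : ℤ) - ∑ q ∈ dpairs d,
      ((n - (q.1.grade + 1)).choose q.2.grade : ℤ) * sN n q.1 * (omegaD q.2 : ℤ) := by
  rw [sN_eq n (d.grade + 1) d (by omega), Finset.sum_range_succ', facT_zero n d hd]
  simp only [facT_succ]
  have : ∀ q ∈ dpairs d, ((n - (q.1.grade + 1)).choose q.2.grade : ℤ) * sN n q.1 * (omegaD q.2 : ℤ)
      = ∑ m ∈ Finset.range d.grade, (-1 : ℤ) ^ m *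
        (((n - (q.1.grade + 1)).choose q.2.grade : ℤ) * facT n m q.1 * (omegaD q.2 : ℤ)) := by
    intro q hq
    have h := congrArg Descent.grade (mem_dpairs.1 hq).2
    rw [grade_dstar] at h
    rw [sN_eq n d.grade q.1 (by omega), Finset.mul_sum, Finset.sum_mul]
    exact Finset.sum_congr rfl fun _ _ => by ring
  rw [Finset.sum_congr rfl this, Finset.sum_comm]
  simp only [pow_succ, mul_neg, mul_one, neg_mul, Finset.sum_neg_distrib, Finset.mul_sum]
  simp
  ring

theorem graft2_single (a b : Descent) (x y : ℝ) :
    graft2 (Finsupp.single a x) (Finsupp.single b y) = Finsupp.single (dstar a b) (x * y) := by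
  unfold graft2
  rw [Finsupp.sum_single_index, Finsupp.sum_single_index] <;> simp

theorem graft2_add_left (x x' y : Descent →₀ ℝ) :
    graft2 (x + x') y = graft2 x y + graft2 x' y := by
  unfold graft2
  rw [Finsupp.sum_add_index']
  · intro a; simp
  · intro a b c; simp [add_mul, Finsupp.single_add, Finsupp.sum_add]

theorem graft2_add_right (x y y' : Descent →₀ ℝ) :
    graft2 x (y + y') = graft2 x y + graft2 x y' := by
  unfold graft2
  rw [← Finsupp.sum_add]
  refine Finsupp.sum_congr fun a _ => ?_
  rw [Finsupp.sum_add_index']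
  · intro a; simp
  · intro a b c; simp [mul_add, Finsupp.single_add]

theorem graft2_sum (s t : Finset Descent) (u v : Descent → ℝ) :
    graft2 (∑ a ∈ s, Finsupp.single a (u a)) (∑ b ∈ t, Finsupp.single b (v b)) =
      ∑ a ∈ s, ∑ b ∈ t, Finsupp.single (dstar a b) (u a * v b) := by
  have hr : ∀ x : Descent →₀ ℝ, graft2 x (∑ b ∈ t, Finsupp.single b (v b)) =
      ∑ b ∈ t, graft2 x (Finsupp.single b (v b)) := fun x =>
    map_sum (AddMonoidHom.mk' (graft2 x) (graft2_add_right x)) _ _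
  have hl : ∀ y : Descent →₀ ℝ, graft2 (∑ a ∈ s, Finsupp.single a (u a)) y =
      ∑ a ∈ s, graft2 (Finsupp.single a (u a)) y := fun y =>
    map_sum (AddMonoidHom.mk' (fun x => graft2 x y) (fun x x' => graft2_add_left x x' y)) _ _
  rw [hl]
  refine Finset.sum_congr rfl fun a _ => ?_
  rw [hr]
  exact Finset.sum_congr rfl fun b _ => graft2_single _ _ _ _

theorem sum_reindex (k : ℕ) (F : Descent → Descent → (Descent →₀ ℝ)) :
    ∑ l ∈ Finset.Icc 2 (k - 1), ∑ a ∈ descentsOfGrade (l - 1),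
      ∑ b ∈ descentsOfGrade (k - 1 - l), F a b =
    ∑ d ∈ descentsOfGrade (k - 1), ∑ q ∈ dpairs d, F q.1 q.2 := by
  simp only [← Finset.sum_product']
  rw [Finset.sum_sigma', Finset.sum_sigma']
  refine Finset.sum_bij' (fun x _ => ⟨dstar x.2.1 x.2.2, x.2⟩) (fun x _ => ⟨x.2.1.grade + 1, x.2⟩)
    ?_ ?_ ?_ ?_ ?_
  · rintro ⟨l, a, b⟩ h
    simp only [Finset.mem_sigma, Finset.mem_Icc, Finset.mem_product, mem_dog, mem_dpairs,
      grade_dstar] at h ⊢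
    refine ⟨by omega, by omega, trivial⟩
  · rintro ⟨d, a, b⟩ h
    simp only [Finset.mem_sigma, Finset.mem_Icc, Finset.mem_product, mem_dog, mem_dpairs] at h ⊢
    obtain ⟨h1, h2, rfl⟩ := h
    rw [grade_dstar] at h1
    omega
  · rintro ⟨l, a, b⟩ h
    simp only [Finset.mem_sigma, Finset.mem_Icc, Finset.mem_product, mem_dog] at h ⊢
    have : a.grade + 1 = l := by omega
    rw [this]
  · rintro ⟨d, a, b⟩ h
    simp only [Finset.mem_sigma, mem_dpairs] at h ⊢
    rw [h.2.2]
  · intros; rfl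

theorem satoB_eq (n k : ℕ) (hk : 2 ≤ k) :
    satoB n k = ∑ d ∈ descentsOfGrade (k - 1), Finsupp.single d (-(sN n d : ℝ)) := by
  induction k using Nat.strong_induction_on with
  | _ k ih =>
  rw [satoB, Finset.sum_attach (Finset.Icc 2 (k - 1)) (fun l =>
    ((n - l).choose (k - 1 - l) : ℝ) • graft2 (satoB n l) (pD (k - 1 - l)))]
  have h1 : ∀ l ∈ Finset.Icc 2 (k - 1),
      ((n - l).choose (k - 1 - l) : ℝ) • graft2 (satoB n l) (pD (k - 1 - l)) =
      ∑ a ∈ descentsOfGrade (l - 1), ∑ b ∈ descentsOfGrade (k - 1 - l),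
        Finsupp.single (dstar a b)
          (-(((n - (a.grade + 1)).choose b.grade : ℝ) * (sN n a : ℝ) * (omegaD b : ℝ))) := by
    intro l hl
    rw [Finset.mem_Icc] at hl
    rw [ih l (by omega) hl.1, pD, graft2_sum, Finset.smul_sum]
    refine Finset.sum_congr rfl fun a ha => ?_
    rw [Finset.smul_sum]
    refine Finset.sum_congr rfl fun b hb => ?_
    rw [mem_dog] at ha hb
    have : a.grade + 1 = l := by omega
    rw [Finsupp.smul_single, smul_eq_mul, this, hb]
    congr 1
    ring
  rw [Finset.sum_congr rfl h1, sum_reindex k (fun a b => Finsupp.single (dstar a b)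
          (-(((n - (a.grade + 1)).choose b.grade : ℝ) * (sN n a : ℝ) * (omegaD b : ℝ)))),
    pD, Finset.smul_sum, ← Finset.sum_neg_distrib, ← Finset.sum_sub_distrib]
  refine Finset.sum_congr rfl fun d hd => ?_
  rw [mem_dog] at hd
  have h2 : ∀ q ∈ dpairs d, Finsupp.single (dstar q.1 q.2)
      (-(((n - (q.1.grade + 1)).choose q.2.grade : ℝ) * (sN n q.1 : ℝ) * (omegaD q.2 : ℝ))) =
      Finsupp.single d
      (-(((n - (q.1.grade + 1)).choose q.2.grade : ℝ) * (sN n q.1 : ℝ) * (omegaD q.2 : ℝ))) := by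
    intro q hq
    rw [(mem_dpairs.1 hq).2]
  rw [Finset.sum_congr rfl h2, ← Finsupp.single_finsetSum, Finsupp.smul_single,
    ← Finsupp.single_neg, ← Finsupp.single_sub, sN_rec n d (by omega), hd]
  congr 1
  push_cast
  rw [Finset.sum_neg_distrib, smul_eq_mul]
  ring

/-- The Sato coefficient endomorphism formula: for `2 ≤ k ≤ n+1`, the Sato coefficient
`b_{n−k}` equals `−Σ_{‖𝔡‖ = k−1} s_n(𝔡) • 𝔡` in the free `ℝ`-module on descents. -/
theorem sato_coefficient_endomorphism (n : ℕ) (hn : 1 ≤ n) (k : ℕ) (hk2 : 2 ≤ k)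
    (hkn : k ≤ n + 1) :
    satoB n k =
      -∑ d ∈ descentsOfGrade (k - 1), (sN n d : ℝ) • Finsupp.single d (1 : ℝ) := by
  rw [satoB_eq n k hk2, ← Finset.sum_neg_distrib]
  refine Finset.sum_congr rfl fun d _ => ?_
  rw [Finsupp.smul_single, smul_eq_mul, mul_one, Finsupp.single_neg]
end

section
/- Fix n ≥ 1 and let 𝔡 be a descent of grade ‖𝔡‖ = n and length |𝔡| = ℓ. Define s_n(𝔡) := Σ_{m ≥ 0} (−1)^m Σ over all left-nested factorizations (𝔡₀, 𝔡₁, …, 𝔡_m) of 𝔡 with 𝔡₀ ≠ ∅₀ of ( ∏_{i=0}^{m} C(n − ‖𝔡₀‖ − ⋯ − ‖𝔡_{i−1}‖ − i, ‖𝔡_i‖) ) · ( ∏_{i=0}^{m} ω(𝔡_i) ). Then s_n(𝔡) = (−1)^{ℓ}. -/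
namespace SatoAux

open Finset

/-- The window of `D` of length `n` starting after position `s`, as a descent. -/
def cut (D : Finset ℕ) (s n : ℕ) : Descent where
  grade := n
  dset := (Finset.Icc 1 (n - 1)).filter (fun e => s + e ∈ D)
  valid := Finset.filter_subset _ _

theorem descent_ext {a b : Descent} (h1 : a.grade = b.grade) (h2 : a.dset = b.dset) : a = b := by
  cases a; cases b; simp_all

theorem descent_ext_iff {a b : Descent} :
    a = b ↔ a.grade = b.grade ∧ ∀ x, x ∈ a.dset ↔ x ∈ b.dset := by
  constructor
  · rintro rfl; simp
  · rintro ⟨h1, h2⟩; exact descent_ext h1 (Finset.ext h2)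

@[simp] theorem cut_grade (D : Finset ℕ) (s n : ℕ) : (cut D s n).grade = n := rfl

theorem mem_cut (D : Finset ℕ) (s n x : ℕ) :
    x ∈ (cut D s n).dset ↔ 1 ≤ x ∧ x < n ∧ s + x ∈ D := by
  simp only [cut, Finset.mem_filter, Finset.mem_Icc]
  constructor
  · rintro ⟨⟨h1, h2⟩, h3⟩; exact ⟨h1, by omega, h3⟩
  · rintro ⟨h1, h2, h3⟩; exact ⟨⟨h1, by omega⟩, h3⟩

theorem cut_congr {D D' : Finset ℕ} {s n : ℕ}
    (h : ∀ x, 1 ≤ x → x < n → (s + x ∈ D ↔ s + x ∈ D')) : cut D s n = cut D' s n := by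
  rw [descent_ext_iff]
  refine ⟨rfl, fun x => ?_⟩
  rw [mem_cut, mem_cut]
  constructor
  · rintro ⟨h1, h2, h3⟩; exact ⟨h1, h2, (h x h1 h2).1 h3⟩
  · rintro ⟨h1, h2, h3⟩; exact ⟨h1, h2, (h x h1 h2).2 h3⟩

theorem dset_bound (d : Descent) {x : ℕ} (hx : x ∈ d.dset) : 1 ≤ x ∧ x < d.grade := by
  have := Finset.mem_Icc.mp (d.valid hx)
  omega

theorem cut_self (d : Descent) : cut d.dset 0 d.grade = d := by
  rw [descent_ext_iff]
  refine ⟨rfl, fun x => ?_⟩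
  rw [mem_cut, Nat.zero_add]
  constructor
  · rintro ⟨_, _, h⟩; exact h
  · intro h; exact ⟨(dset_bound d h).1, (dset_bound d h).2, h⟩

theorem mem_dstar (a b : Descent) (x : ℕ) :
    x ∈ (dstar a b).dset ↔ x ∈ a.dset ∨ (∃ e ∈ b.dset, e + a.grade + 1 = x) ∨
      (1 ≤ a.grade ∧ x = a.grade) := by
  simp only [dstar, Finset.mem_union, Finset.mem_image]
  split_ifs with h <;> simp [h, or_assoc]

theorem dstar_eq_cut (D : Finset ℕ) (s : ℕ) (a b : Descent) :
    dstar a b = cut D s (a.grade + b.grade + 1) ↔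
      a = cut D s a.grade ∧ b = cut D (s + a.grade + 1) b.grade ∧
      (a.grade = 0 ∨ s + a.grade ∈ D) ∧ (b.grade = 0 ∨ s + a.grade + 1 ∉ D) := by
  rw [descent_ext_iff, descent_ext_iff, descent_ext_iff]
  simp only [mem_cut, mem_dstar, cut_grade, true_and]
  have hg : (dstar a b).grade = a.grade + b.grade + 1 := rfl
  simp only [hg, true_and]
  have ha := fun x => @dset_bound a x
  have hb := fun x => @dset_bound b x
  generalize a.grade = p at *
  generalize b.grade = q at *
  generalize a.dset = A at *
  generalize b.dset = B at *
  constructor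
  · intro h
    refine ⟨fun x => ?_, fun x => ?_, ?_, ?_⟩
    · constructor
      · intro hx
        have := (h x).1 (Or.inl hx)
        exact ⟨this.1, (ha x hx).2, this.2.2⟩
      · rintro ⟨h1, h2, h3⟩
        rcases (h x).2 ⟨h1, by omega, h3⟩ with h4 | ⟨e, he, h4⟩ | h4
        · exact h4
        · omega
        · omega
    · constructor
      · intro hx
        have := (h (x + p + 1)).1 (Or.inr (Or.inl ⟨x, hx, rfl⟩))
        refine ⟨(hb x hx).1, (hb x hx).2, ?_⟩
        have e : s + p + 1 + x = s + (x + p + 1) := by omega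
        rw [e]; exact this.2.2
      · rintro ⟨h1, h2, h3⟩
        have e : s + p + 1 + x = s + (x + p + 1) := by omega
        rw [e] at h3
        rcases (h (x + p + 1)).2 ⟨by omega, by omega, h3⟩ with h4 | ⟨e, he, h4⟩ | h4
        · have := ha _ h4; omega
        · have : e = x := by omega
          rw [← this]; exact he
        · omega
    · by_cases hp : p = 0
      · exact Or.inl hp
      · right
        exact ((h p).1 (Or.inr (Or.inr ⟨by omega, rfl⟩))).2.2
    · by_cases hq : q = 0
      · exact Or.inl hq
      · right
        intro hD
        rcases (h (p + 1)).2 ⟨by omega, by omega, hD⟩ with h4 | ⟨e, he, h4⟩ | h4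
        · have := ha _ h4; omega
        · have := hb _ he; omega
        · omega
  · rintro ⟨h1, h2, h3, h4⟩ x
    constructor
    · rintro (hx | ⟨e, he, rfl⟩ | ⟨hp, rfl⟩)
      · have := (h1 x).1 hx
        exact ⟨this.1, by omega, this.2.2⟩
      · have := (h2 e).1 he
        refine ⟨by omega, by omega, ?_⟩
        have e' : s + p + 1 + e = s + (e + p + 1) := by omega
        rw [← e']; exact this.2.2
      · exact ⟨by omega, by omega, by rcases h3 with h3 | h3; omega; exact h3⟩
    · rintro ⟨h5, h6, h7⟩
      rcases lt_trichotomy x p with hlt | heq | hgt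
      · exact Or.inl ((h1 x).2 ⟨h5, hlt, h7⟩)
      · exact Or.inr (Or.inr ⟨by omega, heq⟩)
      · right; left
        by_cases hx : x = p + 1
        · subst hx
          rcases h4 with h4 | h4
          · omega
          · exact absurd h7 h4
        · refine ⟨x - p - 1, (h2 _).2 ⟨by omega, by omega, ?_⟩, by omega⟩
          have e : s + p + 1 + (x - p - 1) = s + x := by omega
          rw [e]; exact h7

/-! ### trees and omega -/

theorem desc_grade (τ : PTree) : (desc τ).grade = τ.grade := by
  induction τ with
  | leaf => rfl
  | node a b iha ihb => simp [desc, dstar, PTree.grade, iha, ihb]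

theorem mem_treesOfGrade (τ : PTree) : ∀ n, τ ∈ treesOfGrade n ↔ τ.grade = n := by
  induction τ with
  | leaf =>
    intro n
    cases n with
    | zero => simp [treesOfGrade, PTree.grade]
    | succ n => simp [treesOfGrade, PTree.grade]
  | node a b iha ihb =>
    intro n
    cases n with
    | zero => simp [treesOfGrade, PTree.grade]
    | succ n =>
      rw [treesOfGrade]
      simp only [mem_biUnion, mem_attach, true_and, mem_image, mem_product, Subtype.exists,
        mem_range, Prod.exists, PTree.node.injEq, PTree.grade]
      constructor
      · rintro ⟨j, hj, x, y, ⟨hx, hy⟩, rfl, rfl⟩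
        rw [iha] at hx; rw [ihb] at hy
        omega
      · intro h
        exact ⟨a.grade, by omega, a, b, ⟨(iha _).2 rfl, (ihb _).2 (by omega)⟩, rfl, rfl⟩

theorem omegaD_eq (d : Descent) :
    omegaD d = ∑ τ ∈ treesOfGrade d.grade, if desc τ = d then τ.alpha else 0 := by
  rw [← Finset.sum_filter, omegaD]
  rw [← finsum_mem_coe_finset]
  apply finsum_congr
  intro τ
  have : desc τ = d ↔ τ ∈ (↑((treesOfGrade d.grade).filter (fun τ => desc τ = d)) : Set PTree) := by
    simp only [Finset.coe_filter, Set.mem_ofPred_eq, mem_treesOfGrade]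
    constructor
    · rintro rfl; exact ⟨(desc_grade τ).symm, rfl⟩
    · exact fun h => h.2
  exact finsum_congr_Prop (propext this) (fun _ => rfl)

theorem sum_trees_succ (n : ℕ) (f : PTree → ℕ) :
    ∑ τ ∈ treesOfGrade (n + 1), f τ =
      ∑ k ∈ range (n + 1), ∑ x ∈ treesOfGrade k, ∑ y ∈ treesOfGrade (n - k),
        f (PTree.node x y) := by
  rw [treesOfGrade, Finset.sum_biUnion]
  · rw [← Finset.sum_attach (range (n + 1))]
    apply Finset.sum_congr rfl
    intro j _
    rw [Finset.sum_image, Finset.sum_product]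
    rintro ⟨a, b⟩ _ ⟨c, d⟩ _ h
    simpa using h
  · intro i _ j _ hij
    rw [Function.onFun, Finset.disjoint_left]
    intro τ hi hj
    simp only [mem_image, mem_product, Prod.exists] at hi hj
    obtain ⟨a, b, ⟨ha, _⟩, rfl⟩ := hi
    obtain ⟨c, d, ⟨hc, _⟩, h⟩ := hj
    simp only [PTree.node.injEq] at h
    rw [mem_treesOfGrade] at ha hc
    apply hij
    apply Subtype.ext
    rw [← ha, ← hc, h.1]

/-- The weight of a window. -/
noncomputable def W (D : Finset ℕ) (s n : ℕ) : ℕ := omegaD (cut D s n)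

theorem W_congr {D D' : Finset ℕ} {s n : ℕ}
    (h : ∀ x, 1 ≤ x → x < n → (s + x ∈ D ↔ s + x ∈ D')) : W D s n = W D' s n := by
  rw [W, W, cut_congr h]

theorem W_zero (D : Finset ℕ) (s : ℕ) : W D s 0 = 1 := by
  rw [W, omegaD_eq, cut_grade, treesOfGrade, Finset.sum_singleton, if_pos]
  · rfl
  · rw [descent_ext_iff]
    refine ⟨rfl, fun x => ?_⟩
    rw [mem_cut]
    simp [desc, emptyDescent]

theorem W_succ (D : Finset ℕ) (s n : ℕ) :
    W D s (n + 1) = ∑ k ∈ range (n + 1),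
      if (k = 0 ∨ s + k ∈ D) ∧ (k = n ∨ s + k + 1 ∉ D) then
        n.choose k * W D s k * W D (s + k + 1) (n - k) else 0 := by
  rw [W, omegaD_eq, cut_grade, sum_trees_succ]
  apply Finset.sum_congr rfl
  intro k hk
  rw [mem_range] at hk
  have key : ∀ x ∈ treesOfGrade k, ∀ y ∈ treesOfGrade (n - k),
      (if desc (PTree.node x y) = cut D s (n + 1) then (PTree.node x y).alpha else 0) =
      if (k = 0 ∨ s + k ∈ D) ∧ (k = n ∨ s + k + 1 ∉ D) then
        n.choose k * ((if desc x = cut D s k then x.alpha else 0) *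
          (if desc y = cut D (s + k + 1) (n - k) then y.alpha else 0)) else 0 := by
    intro x hx y hy
    rw [mem_treesOfGrade] at hx hy
    have h := dstar_eq_cut D s (desc x) (desc y)
    rw [desc_grade, desc_grade, hx, hy, show k + (n - k) + 1 = n + 1 by omega] at h
    have h0 : n - k = 0 ↔ k = n := by omega
    rw [h0] at h
    have ea : (PTree.node x y).alpha = n.choose k * x.alpha * y.alpha := by
      rw [PTree.alpha, hx, hy, show k + (n - k) = n by omega]
    rw [ea, desc]
    simp only [h]
    by_cases c1 : (k = 0 ∨ s + k ∈ D) ∧ (k = n ∨ s + k + 1 ∉ D)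
    · by_cases c2 : desc x = cut D s k
      · by_cases c3 : desc y = cut D (s + k + 1) (n - k)
        · rw [if_pos ⟨c2, c3, c1⟩, if_pos c1, if_pos c2, if_pos c3]; ring
        · rw [if_neg (fun h => c3 h.2.1), if_neg c3]; simp
      · rw [if_neg (fun h => c2 h.1), if_neg c2]; simp
    · rw [if_neg (fun h => c1 h.2.2), if_neg c1]
  rw [Finset.sum_congr rfl (fun x hx => Finset.sum_congr rfl (key x hx))]
  split_ifs with hc
  · rw [W, W, omegaD_eq, omegaD_eq, cut_grade, cut_grade, mul_assoc, Finset.sum_mul_sum,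
      Finset.mul_sum]
    simp only [Finset.mul_sum]
  · simp

theorem W_one (n : ℕ) : ∀ (D : Finset ℕ) (s : ℕ), (∀ x, 1 ≤ x → x < n → s + x ∉ D) →
    W D s n = 1 := by
  induction n with
  | zero => intro D s _; exact W_zero D s
  | succ n ih =>
    intro D s h
    rw [W_succ, Finset.sum_range_succ', Finset.sum_eq_zero, zero_add, if_pos]
    · rw [W_zero, Nat.choose_zero_right]
      simp only [Nat.add_zero, Nat.sub_zero, one_mul]
      apply ih
      intro x h1 h2
      have := h (x + 1) (by omega) (by omega)
      rwa [show s + (x + 1) = s + 1 + x by omega] at this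
    · refine ⟨Or.inl rfl, ?_⟩
      by_cases hn : n = 0
      · left; omega
      · right; exact h 1 le_rfl (by omega)
    · intro k hk
      rw [mem_range] at hk
      rw [if_neg]
      rintro ⟨h1 | h1, _⟩
      · omega
      · exact h (k + 1) (by omega) (by omega) h1

theorem W_insert (n : ℕ) : ∀ (g s : ℕ) (A : Finset ℕ), 1 ≤ g → g < n → (∀ x ∈ A, x < s + g) →
    W (insert (s + g) A) s n + W A s n = n.choose g * W A s g := by
  induction n using Nat.strong_induction_on with
  | _ n ih =>
  intro g s A hg hgn hA
  obtain ⟨n, rfl⟩ : ∃ m, n = m + 1 := ⟨n - 1, by omega⟩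
  obtain ⟨h, rfl⟩ : ∃ h, g = h + 1 := ⟨g - 1, by omega⟩
  have hA' : ∀ x, s + h + 1 ≤ x → x ∉ A := fun x hx hxA => by have := hA x hxA; omega
  rw [W_succ, W_succ, ← Finset.sum_add_distrib]
  have key : ∀ k ∈ range (n + 1),
      ((if (k = 0 ∨ s + k ∈ insert (s + (h + 1)) A) ∧
          (k = n ∨ s + k + 1 ∉ insert (s + (h + 1)) A) then
        n.choose k * W (insert (s + (h + 1)) A) s k *
          W (insert (s + (h + 1)) A) (s + k + 1) (n - k) else 0) +
      (if (k = 0 ∨ s + k ∈ A) ∧ (k = n ∨ s + k + 1 ∉ A) then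
        n.choose k * W A s k * W A (s + k + 1) (n - k) else 0)) =
      (if k ∈ range (h + 1) then n.choose h *
        (if (k = 0 ∨ s + k ∈ A) ∧ (k = h ∨ s + k + 1 ∉ A) then
          h.choose k * W A s k * W A (s + k + 1) (h - k) else 0) else 0) +
      (if k = h + 1 then n.choose (h + 1) * W A s (h + 1) else 0) := by
    intro k hk
    rw [mem_range] at hk
    rcases lt_trichotomy k (h + 1) with hlt | heq | hgt
    · rw [if_pos (mem_range.2 hlt), if_neg (show ¬ k = h + 1 by omega), add_zero]
      have e1 : W (insert (s + (h + 1)) A) s k = W A s k := by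
        apply W_congr
        intro x h1 h2
        rw [Finset.mem_insert]
        constructor
        · rintro (h3 | h3)
          · omega
          · exact h3
        · exact Or.inr
      rcases Nat.lt_or_ge k h with hkh | hkh
      · have m1 : s + k ∈ insert (s + (h + 1)) A ↔ s + k ∈ A := by
          rw [Finset.mem_insert, or_iff_right (by omega)]
        have m2 : s + k + 1 ∈ insert (s + (h + 1)) A ↔ s + k + 1 ∈ A := by
          rw [Finset.mem_insert, or_iff_right (by omega)]
        simp only [m1, m2, e1, show ¬ k = n by omega, show ¬ k = h by omega, false_or]
        split_ifs with hc
        · have := ih (n - k) (by omega) (h - k) (s + k + 1) A (by omega) (by omega) (by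
            intro x hx; have := hA x hx; omega)
          rw [show s + k + 1 + (h - k) = s + (h + 1) by omega] at this
          rw [← mul_add, this]
          have c := Nat.choose_mul (n := n) (k := h) (s := k) (by omega)
          calc n.choose k * W A s k * ((n - k).choose (h - k) * W A (s + k + 1) (h - k))
              = (n.choose k * (n - k).choose (h - k)) * (W A s k * W A (s + k + 1) (h - k)) := by
                ring
            _ = _ := by rw [← c]; ring
        · simp
      · obtain rfl : k = h := by omega
        rw [if_neg, zero_add]
        · have m : s + k + 1 ∉ A := hA' _ le_rfl
          simp only [m, not_false_eq_true, or_true, and_true]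
          split_ifs
          · rw [Nat.sub_self, W_zero, Nat.choose_self,
              W_one (n - k) A (s + k + 1) (fun x _ _ => hA' _ (by omega))]
            ring
          · simp
        · rintro ⟨_, h1 | h1⟩
          · omega
          · exact h1 (Finset.mem_insert.2 (Or.inl (by omega)))
    · subst heq
      rw [if_neg (show ¬ (h + 1 ∈ range (h + 1)) by simp), if_pos rfl, zero_add, if_pos, if_neg,
        add_zero]
      · rw [W_one (n - (h + 1)), mul_one]
        · congr 1
          apply W_congr
          intro x h1 h2
          rw [Finset.mem_insert, or_iff_right (by omega)]
        · intro x h1 h2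
          rw [Finset.mem_insert, not_or]
          exact ⟨by omega, hA' _ (by omega)⟩
      · rintro ⟨h1 | h1, _⟩
        · omega
        · exact hA' _ (by omega) h1
      · refine ⟨Or.inr (Finset.mem_insert_self _ _), Or.inr ?_⟩
        rw [Finset.mem_insert, not_or]
        exact ⟨by omega, hA' _ (by omega)⟩
    · rw [if_neg, if_neg, if_neg (by rw [mem_range]; omega), if_neg (by omega)]
      · rintro ⟨h1 | h1, _⟩
        · omega
        · exact hA' _ (by omega) h1
      · rintro ⟨h1 | h1, _⟩
        · omega
        · rw [Finset.mem_insert] at h1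
          rcases h1 with h1 | h1
          · omega
          · exact hA' _ (by omega) h1
  rw [Finset.sum_congr rfl key, Finset.sum_add_distrib, ← Finset.sum_filter,
    Finset.sum_ite_eq' , if_pos (by rw [mem_range]; omega)]
  have e : (range (n + 1)).filter (fun k => k ∈ range (h + 1)) = range (h + 1) := by
    ext x; simp only [mem_filter, mem_range]; omega
  rw [e, ← Finset.mul_sum, ← W_succ, Nat.choose_succ_succ]
  ring

/-! ### signs -/

/-- Number of elements of `D` strictly inside the window. -/
def c (D : Finset ℕ) (s n : ℕ) : ℕ := ((Finset.Ico (s + 1) (s + n)).filter (fun x => x ∈ D)).card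

theorem c_succ_last (D : Finset ℕ) (s n : ℕ) (hn : 1 ≤ n) :
    c D s (n + 1) = c D s n + if s + n ∈ D then 1 else 0 := by
  have e : Finset.Ico (s + 1) (s + (n + 1)) = insert (s + n) (Finset.Ico (s + 1) (s + n)) := by
    ext x; simp only [Finset.mem_insert, Finset.mem_Ico]; omega
  rw [c, c, e, Finset.filter_insert]
  split_ifs with h
  · rw [Finset.card_insert_of_notMem (by simp)]
  · rfl

theorem c_succ_first (D : Finset ℕ) (s n : ℕ) (hn : 1 ≤ n) :
    c D s (n + 1) = c D (s + 1) n + if s + 1 ∈ D then 1 else 0 := by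
  have e : Finset.Ico (s + 1) (s + (n + 1)) = insert (s + 1) (Finset.Ico (s + 1 + 1) (s + 1 + n)) := by
    ext x; simp only [Finset.mem_insert, Finset.mem_Ico]; omega
  rw [c, c, e, Finset.filter_insert]
  split_ifs with h
  · rw [Finset.card_insert_of_notMem (by simp)]
  · rfl

theorem c_one (D : Finset ℕ) (s : ℕ) : c D s 1 = 0 := by simp [c]

theorem macmahon (D : Finset ℕ) (s n j : ℕ) (hj : 1 ≤ j) : j ≤ n →
    (W (D.filter (fun x => x < s + j)) s n : ℤ) = (-1) ^ c D s j +
      ∑ g ∈ Finset.Ico 1 j, if s + g ∈ D then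
        (-1 : ℤ) ^ c D (s + g) (j - g) * (n.choose g * W D s g) else 0 := by
  induction j, hj using Nat.le_induction with
  | base =>
    intro _
    rw [c_one, W_one]
    · simp
    · intro x h1 h2 h3
      rw [Finset.mem_filter] at h3
      omega
  | succ j hj ih =>
    intro hjn
    have ih := ih (by omega)
    rw [Finset.sum_Ico_succ_top hj, c_succ_last D s j hj]
    have e : ∀ g ∈ Finset.Ico 1 j, (if s + g ∈ D then
        (-1 : ℤ) ^ c D (s + g) (j + 1 - g) * (n.choose g * W D s g) else 0) =
        (if s + j ∈ D then -1 else 1) * (if s + g ∈ D then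
        (-1 : ℤ) ^ c D (s + g) (j - g) * (n.choose g * W D s g) else 0) := by
      intro g hg
      rw [Finset.mem_Ico] at hg
      rw [show j + 1 - g = (j - g) + 1 by omega, c_succ_last _ _ _ (by omega),
        show s + g + (j - g) = s + j by omega]
      split_ifs <;> ring
    rw [Finset.sum_congr rfl e, ← Finset.mul_sum]
    by_cases h : s + j ∈ D
    · have f : D.filter (fun x => x < s + (j + 1)) =
          insert (s + j) (D.filter (fun x => x < s + j)) := by
        ext x
        simp only [Finset.mem_filter, Finset.mem_insert]
        constructor
        · rintro ⟨h1, h2⟩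
          by_cases hx : x = s + j
          · exact Or.inl hx
          · exact Or.inr ⟨h1, by omega⟩
        · rintro (rfl | ⟨h1, h2⟩)
          · exact ⟨h, by omega⟩
          · exact ⟨h1, by omega⟩
      have k := W_insert n j s (D.filter (fun x => x < s + j)) hj (by omega) (by
        intro x hx; exact (Finset.mem_filter.1 hx).2)
      have k2 : W (D.filter (fun x => x < s + j)) s j = W D s j := by
        apply W_congr
        intro x h1 h2
        rw [Finset.mem_filter, and_iff_left (by omega)]
      rw [← f, k2] at k
      have k' : (W (D.filter (fun x => x < s + (j + 1))) s n : ℤ) +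
        W (D.filter (fun x => x < s + j)) s n = n.choose j * W D s j := by exact_mod_cast k
      simp only [h, if_true, Nat.add_sub_cancel_left, c_one]
      rw [pow_succ]
      linarith
    · have f : D.filter (fun x => x < s + (j + 1)) = D.filter (fun x => x < s + j) := by
        ext x
        simp only [Finset.mem_filter]
        constructor
        · rintro ⟨h1, h2⟩
          refine ⟨h1, ?_⟩
          have : x ≠ s + j := by rintro rfl; exact h h1
          omega
        · rintro ⟨h1, h2⟩
          exact ⟨h1, by omega⟩
      rw [f, ih]
      simp [h]

theorem key_sum (D : Finset ℕ) (s n : ℕ) (hn : 1 ≤ n) :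
    (∑ g ∈ Finset.Icc 1 n, if g = n ∨ s + g ∈ D then
      (n.choose g * W D s g : ℤ) *
        (if n - g = 0 then 1 else -(-1 : ℤ) ^ c D (s + g) (n - g)) else 0) = (-1) ^ c D s n := by
  have e : Finset.Icc 1 n = Finset.Ico 1 (n + 1) := by ext x; simp only [Finset.mem_Icc, Finset.mem_Ico]; omega
  have m := macmahon D s n n hn le_rfl
  have w : W (D.filter (fun x => x < s + n)) s n = W D s n := by
    apply W_congr
    intro x h1 h2
    rw [Finset.mem_filter, and_iff_left (by omega)]
  rw [w] at m
  rw [e, Finset.sum_Ico_succ_top hn]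
  have t : ∀ g ∈ Finset.Ico 1 n, (if g = n ∨ s + g ∈ D then
      (n.choose g * W D s g : ℤ) *
        (if n - g = 0 then 1 else -(-1 : ℤ) ^ c D (s + g) (n - g)) else 0) =
      -(if s + g ∈ D then
        (-1 : ℤ) ^ c D (s + g) (n - g) * (n.choose g * W D s g) else 0) := by
    intro g hg
    rw [Finset.mem_Ico] at hg
    simp only [show ¬ g = n by omega, false_or, if_neg (show ¬ n - g = 0 by omega)]
    split_ifs <;> ring
  rw [Finset.sum_congr rfl t, Finset.sum_neg_distrib]
  simp only [true_or, if_true, Nat.sub_self, Nat.choose_self]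
  rw [m]
  push_cast
  ring

/-! ### factorizations -/

/-- Possible tails of a factorization. -/
def tails (D : Finset ℕ) (s : ℕ) : ℕ → Finset (List Descent)
  | 0 => {[]}
  | n + 1 =>
    (Finset.range (n + 1)).attach.biUnion fun g =>
      if (g.1 = 0 ∨ s + 1 ∉ D) ∧ (g.1 = n ∨ s + g.1 + 1 ∈ D) then
        (tails D (s + g.1 + 1) (n - g.1)).image (fun L => cut D (s + 1) g.1 :: L) else ∅
termination_by n => n
decreasing_by exact Nat.lt_succ_of_le (Nat.sub_le n g.1)

theorem nil_mem_tails (D : Finset ℕ) (s n : ℕ) : [] ∈ tails D s n ↔ n = 0 := by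
  cases n with
  | zero => simp [tails]
  | succ n =>
    rw [tails]
    simp only [mem_biUnion, mem_attach, true_and, Subtype.exists, mem_range]
    constructor
    · rintro ⟨g, _, h⟩
      split_ifs at h <;> simp at h
    · intro h; omega

theorem cons_mem_tails (D : Finset ℕ) (s n : ℕ) (b : Descent) (L : List Descent) :
    b :: L ∈ tails D s n ↔ b.grade < n ∧ b = cut D (s + 1) b.grade ∧
      (b.grade = 0 ∨ s + 1 ∉ D) ∧ (b.grade + 1 = n ∨ s + b.grade + 1 ∈ D) ∧
      L ∈ tails D (s + b.grade + 1) (n - b.grade - 1) := by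
  cases n with
  | zero => simp [tails]
  | succ n =>
    rw [tails]
    simp only [mem_biUnion, mem_attach, true_and, Subtype.exists, mem_range]
    constructor
    · rintro ⟨g, hg, h⟩
      split_ifs at h with hc
      · simp only [mem_image, List.cons.injEq] at h
        obtain ⟨L', hL, rfl, rfl⟩ := h
        simp only [cut_grade, true_and]
        refine ⟨hg, hc.1, ?_, ?_⟩
        · rcases hc.2 with h | h
          · left; omega
          · exact Or.inr h
        · rwa [show n + 1 - g - 1 = n - g by omega]
      · simp at h
    · rintro ⟨h1, h2, h3, h4, h5⟩
      refine ⟨b.grade, h1, ?_⟩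
      rw [if_pos ⟨h3, by rcases h4 with h | h; (left; omega); exact Or.inr h⟩]
      rw [mem_image]
      refine ⟨L, ?_, by rw [← h2]⟩
      rwa [show n + 1 - b.grade - 1 = n - b.grade by omega] at h5

theorem foldl_eq_iff (d : Descent) (L : List Descent) : ∀ a : Descent, 1 ≤ a.grade →
    (L.foldl dstar a = d ↔ a = cut d.dset 0 a.grade ∧ a.grade ≤ d.grade ∧
      (a.grade = d.grade ∨ a.grade ∈ d.dset) ∧ L ∈ tails d.dset a.grade (d.grade - a.grade)) := by
  induction L with
  | nil =>
    intro a ha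
    rw [List.foldl_nil, nil_mem_tails]
    constructor
    · rintro rfl
      exact ⟨(cut_self a).symm, le_rfl, Or.inl rfl, by omega⟩
    · rintro ⟨h1, h2, h3, h4⟩
      have : a.grade = d.grade := by omega
      rw [h1, this, cut_self]
  | cons b L ih =>
    intro a ha
    have hg : (dstar a b).grade = a.grade + b.grade + 1 := rfl
    rw [List.foldl_cons, ih (dstar a b) (by omega), hg, dstar_eq_cut, cons_mem_tails]
    simp only [Nat.zero_add]
    rw [show d.grade - (a.grade + b.grade + 1) = d.grade - a.grade - b.grade - 1 by omega]
    constructor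
    · rintro ⟨⟨h1, h2, h3, h4⟩, h5, h6, h7⟩
      refine ⟨h1, by omega, Or.inr ?_, by omega, h2, h4, ?_, h7⟩
      · rcases h3 with h3 | h3
        · omega
        · exact h3
      · rcases h6 with h6 | h6
        · left; omega
        · exact Or.inr h6
    · rintro ⟨h1, h2, h3, h4, h5, h6, h7, h8⟩
      refine ⟨⟨h1, h5, Or.inr ?_, h6⟩, by omega, ?_, h8⟩
      · rcases h3 with h3 | h3
        · omega
        · exact h3
      · rcases h7 with h7 | h7
        · left; omega
        · exact Or.inr h7

/-- Weight of a list of descents. -/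
noncomputable def wt (n : ℕ) (M : List Descent) : ℤ :=
  ((satoCoef n M * (M.map omegaD).prod : ℕ) : ℤ)

theorem wt_nil (n : ℕ) : wt n [] = 1 := by simp [wt, satoCoef]

theorem wt_cons (n : ℕ) (a : Descent) (L : List Descent) :
    wt n (a :: L) = (n.choose a.grade * omegaD a : ℤ) * wt (n - a.grade - 1) L := by
  have h : satoCoef n (a :: L) = n.choose a.grade * satoCoef (n - a.grade - 1) L := by
    rw [satoCoef, satoCoef, List.length_cons, Finset.prod_range_succ', mul_comm]
    congr 1
    apply Finset.prod_congr rfl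
    intro i _
    simp only [List.take_succ_cons, List.map_cons, List.sum_cons, List.getD_cons_succ]
    congr 1
    omega
  rw [wt, wt, h]
  simp only [List.map_cons, List.prod_cons]
  push_cast
  ring

/-- Signed sum over tails. -/
noncomputable def H (D : Finset ℕ) (s n : ℕ) : ℤ :=
  ∑ L ∈ tails D s n, (-1 : ℤ) ^ L.length * wt (n - 1) L

theorem H_zero (D : Finset ℕ) (s : ℕ) : H D s 0 = 1 := by
  simp [H, tails, wt_nil]

theorem H_succ (D : Finset ℕ) (s n : ℕ) :
    H D s (n + 1) = -∑ g ∈ range (n + 1),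
      if (g = 0 ∨ s + 1 ∉ D) ∧ (g = n ∨ s + g + 1 ∈ D) then
        (n.choose g * W D (s + 1) g : ℤ) * H D (s + g + 1) (n - g) else 0 := by
  rw [H, tails, Finset.sum_biUnion]
  · rw [← Finset.sum_attach (range (n + 1)), ← Finset.sum_neg_distrib]
    apply Finset.sum_congr rfl
    intro g _
    split_ifs with hc
    · rw [Finset.sum_image (by intro x _ y _ h; simpa using h), H, Finset.mul_sum,
        ← Finset.sum_neg_distrib]
      apply Finset.sum_congr rfl
      intro L _
      rw [wt_cons, List.length_cons, cut_grade, Nat.add_sub_cancel, W, pow_succ]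
      ring
    · simp
  · intro i _ j _ hij
    rw [Function.onFun, Finset.disjoint_left]
    intro L hi hj
    split_ifs at hi hj
    · simp only [mem_image] at hi hj
      obtain ⟨L1, _, rfl⟩ := hi
      obtain ⟨L2, _, h⟩ := hj
      simp only [List.cons.injEq] at h
      apply hij
      apply Subtype.ext
      have := congrArg Descent.grade h.1
      simpa using this.symm
    all_goals simp_all

theorem H_eq (n : ℕ) : ∀ (D : Finset ℕ) (s : ℕ),
    H D s n = if n = 0 then 1 else -(-1 : ℤ) ^ c D s n := by
  induction n using Nat.strong_induction_on with
  | _ n ih =>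
  intro D s
  rcases Nat.eq_zero_or_pos n with rfl | hn
  · simp [H_zero]
  obtain ⟨n, rfl⟩ : ∃ m, n = m + 1 := ⟨n - 1, by omega⟩
  rw [if_neg (by omega), H_succ]
  congr 1
  rcases Nat.eq_zero_or_pos n with rfl | hn'
  · simp [H_zero, W_zero, c_one]
  rw [c_succ_first D s n hn']
  rw [Finset.sum_range_succ']
  by_cases hs : s + 1 ∈ D
  · rw [Finset.sum_eq_zero]
    · rw [if_pos ⟨Or.inl rfl, Or.inr hs⟩, W_zero, if_pos hs, Nat.add_zero, Nat.sub_zero,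
        ih n (by omega), if_neg (by omega), pow_succ]
      simp
    · intro g _
      rw [if_neg]
      rintro ⟨h | h, _⟩
      · omega
      · exact h hs
  · rw [if_neg hs, Nat.add_zero (c D (s + 1) n), ← key_sum D (s + 1) n hn']
    have z : ¬((0 = 0 ∨ s + 1 ∉ D) ∧ (0 = n ∨ s + 0 + 1 ∈ D)) := by
      rintro ⟨_, h | h⟩
      · omega
      · exact hs h
    rw [if_neg z, add_zero]
    have e : Finset.Icc 1 n = Finset.Ico 1 (n + 1) := by
      ext x; simp only [Finset.mem_Icc, Finset.mem_Ico]; omega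
    rw [e, Finset.sum_Ico_eq_sum_range, Nat.add_sub_cancel]
    apply Finset.sum_congr rfl
    intro g hg
    rw [ih (n - (g + 1)) (by omega), show 1 + g = g + 1 by omega,
      show s + 1 + (g + 1) = s + (g + 1) + 1 by omega]
    simp only [hs, not_false_eq_true, or_true, true_and]

/-- All factorizations. -/
def facts (D : Finset ℕ) (n : ℕ) : Finset (Descent × List Descent) :=
  (Finset.Icc 1 n).biUnion fun g =>
    if g = n ∨ 0 + g ∈ D then (tails D g (n - g)).image (fun L => (cut D 0 g, L)) else ∅

theorem mem_facts (d : Descent) (p : Descent × List Descent) :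
    p ∈ facts d.dset d.grade ↔ p.1 ≠ emptyDescent ∧ p.2.foldl dstar p.1 = d := by
  have he : p.1 ≠ emptyDescent ↔ 1 ≤ p.1.grade := by
    constructor
    · intro h
      by_contra h0
      apply h
      rw [descent_ext_iff]
      refine ⟨by simp only [emptyDescent]; omega, fun x => ?_⟩
      constructor
      · intro hx; have := dset_bound _ hx; omega
      · intro hx; simp [emptyDescent] at hx
    · intro h h0
      rw [h0] at h
      simp [emptyDescent] at h
  rw [he, facts, Finset.mem_biUnion]
  constructor
  · rintro ⟨g, hg, hp⟩
    rw [Finset.mem_Icc] at hg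
    split_ifs at hp with hc
    · rw [Finset.mem_image] at hp
      obtain ⟨L, hL, rfl⟩ := hp
      rw [Nat.zero_add] at hc
      exact ⟨hg.1, (foldl_eq_iff d L (cut d.dset 0 g) hg.1).2 ⟨rfl, hg.2, hc, hL⟩⟩
    · simp at hp
  · rintro ⟨h1, h2⟩
    obtain ⟨h3, h4, h5, h6⟩ := (foldl_eq_iff d p.2 p.1 h1).1 h2
    refine ⟨p.1.grade, Finset.mem_Icc.2 ⟨h1, h4⟩, ?_⟩
    rw [if_pos (by rwa [Nat.zero_add]), Finset.mem_image]
    refine ⟨p.2, h6, ?_⟩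
    rw [← h3]

theorem sum_facts (D : Finset ℕ) (n : ℕ) (hn : 1 ≤ n) :
    ∑ p ∈ facts D n, (-1 : ℤ) ^ p.2.length * wt n (p.1 :: p.2) = (-1) ^ c D 0 n := by
  rw [← key_sum D 0 n hn, facts, Finset.sum_biUnion]
  · apply Finset.sum_congr rfl
    intro g _
    split_ifs with hc hz
    · rw [Finset.sum_image (by intro x _ y _ h; simpa using h)]
      have h := H_eq (n - g) D g
      rw [if_pos hz] at h
      rw [show (n.choose g * W D 0 g : ℤ) * 1 = n.choose g * W D 0 g * H D g (n - g) by rw [h], H, Finset.mul_sum]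
      apply Finset.sum_congr rfl
      intro L _
      rw [wt_cons, cut_grade, W]
      ring
    · rw [Finset.sum_image (by intro x _ y _ h; simpa using h)]
      have h := H_eq (n - g) D g
      rw [if_neg hz] at h
      rw [Nat.zero_add, ← h, H, Finset.mul_sum]
      apply Finset.sum_congr rfl
      intro L _
      rw [wt_cons, cut_grade, W]
      ring
    · simp
  · intro i _ j _ hij
    rw [Function.onFun, Finset.disjoint_left]
    intro L hi hj
    split_ifs at hi hj
    · simp only [mem_image] at hi hj
      obtain ⟨L1, _, rfl⟩ := hi
      obtain ⟨L2, _, h⟩ := hj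
      simp only [Prod.mk.injEq] at h
      apply hij
      have := congrArg Descent.grade h.1
      simpa using this.symm
    all_goals simp_all

theorem sN_eq_sum (n : ℕ) (d : Descent) :
    sN n d = ∑ p ∈ facts d.dset d.grade, (-1 : ℤ) ^ p.2.length * wt n (p.1 :: p.2) := by
  have inner : ∀ m : ℕ, (∑ᶠ (p : Descent × List Descent)
      (_ : p.2.length = m ∧ p.1 ≠ emptyDescent ∧ p.2.foldl dstar p.1 = d),
      ((satoCoef n (p.1 :: p.2) * ((p.1 :: p.2).map omegaD).prod : ℕ) : ℤ)) =
      ∑ p ∈ (facts d.dset d.grade).filter (fun p => p.2.length = m), wt n (p.1 :: p.2) := by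
    intro m
    rw [← finsum_mem_coe_finset]
    apply finsum_congr
    intro p
    apply finsum_congr_Prop
    · intro _; rfl
    · rw [Finset.mem_coe, Finset.mem_filter, mem_facts]
      exact propext and_comm
  rw [sN]
  simp only [inner]
  rw [finsum_eq_sum_of_support_subset (s := (facts d.dset d.grade).image (fun p => p.2.length))]
  · rw [← Finset.sum_fiberwise_of_maps_to (t := (facts d.dset d.grade).image (fun p => p.2.length))
      (g := fun p : Descent × List Descent => p.2.length)
      (fun p hp => Finset.mem_image_of_mem (fun p : Descent × List Descent => p.2.length) hp)]
    apply Finset.sum_congr rfl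
    intro m _
    rw [Finset.mul_sum]
    apply Finset.sum_congr rfl
    intro p hp
    rw [(Finset.mem_filter.1 hp).2]
  · intro m hm
    by_contra hc
    apply hm
    show _ * _ = (0 : ℤ)
    rw [Finset.sum_eq_zero, mul_zero]
    intro p hp
    rw [Finset.mem_filter] at hp
    exfalso
    apply hc
    rw [Finset.mem_coe, Finset.mem_image]
    exact ⟨p, hp⟩

theorem c_dset (d : Descent) : c d.dset 0 d.grade = d.dset.card := by
  rw [c]
  congr 1
  ext x
  simp only [Finset.mem_filter, Finset.mem_Ico]
  constructor
  · exact fun h => h.2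
  · intro h
    have := dset_bound d h
    exact ⟨by omega, h⟩

end SatoAux

/-- The main combinatorial theorem (Sato coefficient via descents): for a descent `𝔡` of
grade `n ≥ 1`, `s_n(𝔡) = (−1)^{|𝔡|}` where `|𝔡|` is the length of the descent. -/
theorem sN_eq_neg_one_pow_length (n : ℕ) (hn : 1 ≤ n) (d : Descent) (hd : d.grade = n) :
    sN n d = (-1 : ℤ) ^ d.dset.card := by
  subst hd
  rw [SatoAux.sN_eq_sum, SatoAux.sum_facts _ _ hn, SatoAux.c_dset]
end
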